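/- arXiv:2310.14470 — 9 statements merged into one kernel-verified Lean document; each statement's English description precedes it below -/
import Mathlib

section
/- With the triangle parameterization y(α,β) = y₀ − α L₁ v̂ − β L₂ ŵ, field point x_f, x₀ = x_f − y₀, R = R(α,β) = √(‖x_f − y(α,β)‖² + ε²), and linear force density f(α,β) = f₀ + α f_a + β f_b, the following pointwise identity holds for all (α,β): S^ε(x_f, y(α,β))·f(α,β) = f₀/R + P₀₀/R³ + α(f_a/R + P₁₀/R³) + β(f_b/R + P₀₁/R³) + α² P₂₀/R³ + αβ P₁₁/R³ + β² P₀₂/R³ + α³ P₃₀/R³ + α²β P₂₁/R³ + αβ² P₁₂/R³ + β³ P₀₃/R³, where the constant vectors are P₀₀ = ε² f₀ + (f₀·x₀)x₀; P₁₀ = ε² f_a + (L₁ f₀·v̂ + f_a·x₀)x₀ + (L₁ f₀·x₀)v̂; P₀₁ = ε² f_b + (L₂ f₀·ŵ + f_b·x₀)x₀ + (L₂ f₀·x₀)ŵ; P₂₀ = (L₁ f_a·v̂)x₀ + (L₁² f₀·v̂ + L₁ f_a·x₀)v̂; P₁₁ = (L₁ f_b·v̂ + L₂ f_a·ŵ)x₀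 + (L₁L₂ f₀·ŵ + L₁ f_b·x₀)v̂ + (L₁L₂ f₀·v̂ + L₂ f_a·x₀)ŵ; P₀₂ = (L₂ f_b·ŵ)x₀ + (L₂² f₀·ŵ + L₂ f_b·x₀)ŵ; P₃₀ = (L₁² f_a·v̂)v̂; P₂₁ = (L₁L₂ f_a·ŵ + L₁² f_b·v̂)v̂ + (L₁L₂ f_a·v̂)ŵ; P₁₂ = (L₁L₂ f_b·v̂ + L₂² f_a·ŵ)ŵ + (L₁L₂ f_b·ŵ)v̂; P₀₃ = (L₂² f_b·ŵ)ŵ. -/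
open scoped RealInnerProductSpace

/-- Pointwise expansion of the regularized Stokeslet kernel applied to the linear
force density over a triangle, as a cubic polynomial in `(α,β)` with constant
vector coefficients `P_{i,j}`. -/
theorem regularized_stokeslet_kernel_expansion
    (y₀ y₁ y₂ xf f₀ f₁ f₂ : EuclideanSpace ℝ (Fin 3))
    (hy01 : y₀ ≠ y₁) (hy12 : y₁ ≠ y₂)
    (L₁ L₂ ε : ℝ) (v w x₀ fa fb : EuclideanSpace ℝ (Fin 3))
    (hL₁ : L₁ = ‖y₀ - y₁‖) (hv : v = L₁⁻¹ • (y₀ - y₁))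
    (hL₂ : L₂ = ‖y₁ - y₂‖) (hw : w = L₂⁻¹ • (y₁ - y₂))
    (hx₀ : x₀ = xf - y₀) (hε : 0 < ε)
    (hfa : fa = f₁ - f₀) (hfb : fb = f₂ - f₁)
    (y : ℝ → ℝ → EuclideanSpace ℝ (Fin 3))
    (hy : ∀ α β : ℝ, y α β = y₀ - (α * L₁) • v - (β * L₂) • w)
    (f : ℝ → ℝ → EuclideanSpace ℝ (Fin 3))
    (hf : ∀ α β : ℝ, f α β = f₀ + α • fa + β • fb)
    (R : ℝ → ℝ → ℝ)
    (hR : ∀ α β : ℝ, R α β = Real.sqrt (‖xf - y α β‖^2 + ε^2))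
    (S : EuclideanSpace ℝ (Fin 3) → EuclideanSpace ℝ (Fin 3) →
         EuclideanSpace ℝ (Fin 3) → EuclideanSpace ℝ (Fin 3))
    (hS : ∀ x yy g, S x yy g =
      (1 / Real.sqrt (‖x - yy‖^2 + ε^2) +
        ε^2 / (Real.sqrt (‖x - yy‖^2 + ε^2))^3) • g +
      (⟪x - yy, g⟫ / (Real.sqrt (‖x - yy‖^2 + ε^2))^3) • (x - yy))
    (P₀₀ P₁₀ P₀₁ P₂₀ P₁₁ P₀₂ P₃₀ P₂₁ P₁₂ P₀₃ : EuclideanSpace ℝ (Fin 3))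
    (hP₀₀ : P₀₀ = ε^2 • f₀ + ⟪f₀, x₀⟫ • x₀)
    (hP₁₀ : P₁₀ = ε^2 • fa + (L₁ * ⟪f₀, v⟫ + ⟪fa, x₀⟫) • x₀ +
      (L₁ * ⟪f₀, x₀⟫) • v)
    (hP₀₁ : P₀₁ = ε^2 • fb + (L₂ * ⟪f₀, w⟫ + ⟪fb, x₀⟫) • x₀ +
      (L₂ * ⟪f₀, x₀⟫) • w)
    (hP₂₀ : P₂₀ = (L₁ * ⟪fa, v⟫) • x₀ + (L₁^2 * ⟪f₀, v⟫ + L₁ * ⟪fa, x₀⟫) • v)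
    (hP₁₁ : P₁₁ = (L₁ * ⟪fb, v⟫ + L₂ * ⟪fa, w⟫) • x₀ +
      (L₁ * L₂ * ⟪f₀, w⟫ + L₁ * ⟪fb, x₀⟫) • v +
      (L₁ * L₂ * ⟪f₀, v⟫ + L₂ * ⟪fa, x₀⟫) • w)
    (hP₀₂ : P₀₂ = (L₂ * ⟪fb, w⟫) • x₀ + (L₂^2 * ⟪f₀, w⟫ + L₂ * ⟪fb, x₀⟫) • w)
    (hP₃₀ : P₃₀ = (L₁^2 * ⟪fa, v⟫) • v)
    (hP₂₁ : P₂₁ = (L₁ * L₂ * ⟪fa, w⟫ + L₁^2 * ⟪fb, v⟫) • v +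
      (L₁ * L₂ * ⟪fa, v⟫) • w)
    (hP₁₂ : P₁₂ = (L₁ * L₂ * ⟪fb, v⟫ + L₂^2 * ⟪fa, w⟫) • w +
      (L₁ * L₂ * ⟪fb, w⟫) • v)
    (hP₀₃ : P₀₃ = (L₂^2 * ⟪fb, w⟫) • w) :
    ∀ α β : ℝ,
      S xf (y α β) (f α β) =
        (1 / R α β) • f₀ + ((R α β)^3)⁻¹ • P₀₀ +
        α • ((1 / R α β) • fa + ((R α β)^3)⁻¹ • P₁₀) +
        β • ((1 / R α β) • fb + ((R α β)^3)⁻¹ • P₀₁) +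
        (α^2 / (R α β)^3) • P₂₀ + (α * β / (R α β)^3) • P₁₁ +
        (β^2 / (R α β)^3) • P₀₂ +
        (α^3 / (R α β)^3) • P₃₀ + (α^2 * β / (R α β)^3) • P₂₁ +
        (α * β^2 / (R α β)^3) • P₁₂ + (β^3 / (R α β)^3) • P₀₃ := by
  intro α β
  have hx : xf - y α β = x₀ + (α * L₁) • v + (β * L₂) • w := by
    rw [hy, hx₀]
    abel
  rw [hS, ← hR, hx, hf, hP₀₀, hP₁₀, hP₀₁, hP₂₀, hP₁₁, hP₀₂, hP₃₀, hP₂₁, hP₁₂, hP₀₃,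
    real_inner_comm]
  simp only [inner_add_left, inner_add_right, real_inner_smul_left, real_inner_smul_right]
  module
end

section
/- With the triangle parameterization and T_{m,n,q} = ∫₀¹ ∫₀^α αᵐ βⁿ R(α,β)^{−q} dβ dα, for all natural numbers m, n and every real q, the following identity holds: ∫₀¹ βⁿ R(1,β)^{2−q} dβ − ∫₀¹ α^{m+n} R(α,α)^{2−q} dα = m T_{m−1,n,q−2} − (q−2)[L₁(x₀·v̂) T_{m,n,q} + L₁² T_{m+1,n,q} + L₁L₂(v̂·ŵ) T_{m,n+1,q}], where for m = 0 the term m T_{m−1,n,q−2} is interpreted as 0. (This is the identity A_{m,n,q−2} = m T_{m−1,n,q−2} − (q−2)(···) obtained by integrating the α-derivative of αᵐβⁿR^{2−q} over the parameter triangle, with the boundary integral A expressed as the two line integrals on the left.) -/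
open scoped RealInnerProductSpace

open MeasureTheory in
/-- Exchange of the order of integration over the triangle `0 ≤ y ≤ x ≤ 1`. -/
theorem intervalIntegral_triangle_swap {F : ℝ → ℝ → ℝ} (hF : Continuous (Function.uncurry F)) :
    ∫ x in (0:ℝ)..1, ∫ y in (0:ℝ)..x, F x y = ∫ y in (0:ℝ)..1, ∫ x in y..1, F x y := by
  have hS : MeasurableSet {p : ℝ × ℝ | p.2 ≤ p.1} :=
    measurableSet_le measurable_snd measurable_fst
  have h_int : IntegrableOn
      (Function.uncurry fun x y => {p : ℝ × ℝ | p.2 ≤ p.1}.indicator (Function.uncurry F) (x, y))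
      (Set.uIoc (0:ℝ) 1 ×ˢ Set.uIoc (0:ℝ) 1) :=
    ((hF.continuousOn.integrableOn_compact (isCompact_uIcc.prod isCompact_uIcc)).mono_set
      (Set.prod_mono Set.uIoc_subset_uIcc Set.uIoc_subset_uIcc)).indicator hS
  have h_swap := intervalIntegral_intervalIntegral_swap h_int
  have h_left : ∀ x ∈ Set.uIcc (0:ℝ) 1, ∫ y in (0:ℝ)..1,
      {p : ℝ × ℝ | p.2 ≤ p.1}.indicator (Function.uncurry F) (x, y) =
      ∫ y in (0:ℝ)..x, F x y := by
    intro x hx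
    rw [Set.uIcc_of_le zero_le_one] at hx
    exact intervalIntegral.integral_indicator (f := F x) hx
  have h_right : ∀ y ∈ Set.uIcc (0:ℝ) 1, ∫ x in (0:ℝ)..1,
      {p : ℝ × ℝ | p.2 ≤ p.1}.indicator (Function.uncurry F) (x, y) =
      ∫ x in y..1, F x y := by
    intro y hy
    rw [Set.uIcc_of_le zero_le_one] at hy
    have h_inter : Set.Icc 0 1 ∩ Set.Ici y = Set.Icc y 1 := by
      ext x
      simp only [Set.mem_inter_iff, Set.mem_Icc, Set.mem_Ici]
      exact ⟨fun h => ⟨h.2, h.1.2⟩, fun h => ⟨⟨hy.1.trans h.1, h.2⟩, h.1⟩⟩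
    rw [intervalIntegral.integral_of_le zero_le_one, intervalIntegral.integral_of_le hy.2,
      ← integral_Icc_eq_integral_Ioc, ← integral_Icc_eq_integral_Ioc,
      show (fun x => {p : ℝ × ℝ | p.2 ≤ p.1}.indicator (Function.uncurry F) (x, y)) =
        (Set.Ici y).indicator (fun x => F x y) from rfl,
      setIntegral_indicator measurableSet_Ici, h_inter]
  rw [← intervalIntegral.integral_congr h_left, h_swap, intervalIntegral.integral_congr h_right]

/-- The integral of a partial derivative over the triangle `0 ≤ y ≤ x ≤ 1` is the difference of
the integrals over the vertical edge and over the diagonal. -/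
theorem intervalIntegral_triangle_deriv {f F : ℝ → ℝ → ℝ}
    (hf : Continuous (Function.uncurry f)) (hF : Continuous (Function.uncurry F))
    (hderiv : ∀ x y, HasDerivAt (fun t => f t y) (F x y) x) :
    ∫ x in (0:ℝ)..1, ∫ y in (0:ℝ)..x, F x y =
      (∫ y in (0:ℝ)..1, f 1 y) - ∫ y in (0:ℝ)..1, f y y := by
  have h_inner : ∀ y, ∫ x in y..1, F x y = f 1 y - f y y := fun y =>
    intervalIntegral.integral_eq_sub_of_hasDerivAt (fun x _ => hderiv x y)
      (hF.uncurry_right y |>.intervalIntegrable _ _)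
  simp_rw [intervalIntegral_triangle_swap hF, h_inner]
  exact intervalIntegral.integral_sub ((hf.uncurry_left 1).intervalIntegrable _ _)
    ((hf.comp (continuous_id.prodMk continuous_id)).intervalIntegrable _ _)

/-- Iterated integrals of continuous functions over the triangle are linear. -/
theorem intervalIntegral_triangle_linear {f g : ℝ → ℝ → ℝ} (hf : Continuous (Function.uncurry f))
    (hg : Continuous (Function.uncurry g)) (a b : ℝ) :
    ∫ x in (0:ℝ)..1, ∫ y in (0:ℝ)..x, (a * f x y + b * g x y) =
      a * (∫ x in (0:ℝ)..1, ∫ y in (0:ℝ)..x, f x y) +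
        b * ∫ x in (0:ℝ)..1, ∫ y in (0:ℝ)..x, g x y := by
  have h_inner : ∀ x : ℝ, ∫ y in (0:ℝ)..x, (a * f x y + b * g x y) =
      a * (∫ y in (0:ℝ)..x, f x y) + b * ∫ y in (0:ℝ)..x, g x y := by
    intro x
    rw [intervalIntegral.integral_add
      (((hf.uncurry_left x).const_mul a).intervalIntegrable _ _)
      (((hg.uncurry_left x).const_mul b).intervalIntegrable _ _),
      intervalIntegral.integral_const_mul, intervalIntegral.integral_const_mul]
  have hcf : Continuous fun x : ℝ => ∫ y in (0:ℝ)..x, f x y := intervalIntegral.continuous_parametric_intervalIntegral_of_continuous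
    (μ := MeasureTheory.volume) (a₀ := 0) hf continuous_id
  have hcg : Continuous fun x : ℝ => ∫ y in (0:ℝ)..x, g x y := intervalIntegral.continuous_parametric_intervalIntegral_of_continuous
    (μ := MeasureTheory.volume) (a₀ := 0) hg continuous_id
  simp_rw [h_inner]
  rw [intervalIntegral.integral_add ((hcf.const_mul a).intervalIntegrable _ _)
      ((hcg.const_mul b).intervalIntegrable _ _),
      intervalIntegral.integral_const_mul, intervalIntegral.integral_const_mul]

/-- Integrated `α`-derivative identity `A_{m,n,q−2} = m T_{m−1,n,q−2} − (q−2)(···)`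
for the triangle integrals `T_{m,n,q}`, with the boundary term written as two
line integrals. -/
theorem A_identity_for_T_integrals
    (y₀ y₁ y₂ xf : EuclideanSpace ℝ (Fin 3))
    (hy01 : y₀ ≠ y₁) (hy12 : y₁ ≠ y₂)
    (L₁ L₂ ε : ℝ) (v w x₀ : EuclideanSpace ℝ (Fin 3))
    (hL₁ : L₁ = ‖y₀ - y₁‖) (hv : v = L₁⁻¹ • (y₀ - y₁))
    (hL₂ : L₂ = ‖y₁ - y₂‖) (hw : w = L₂⁻¹ • (y₁ - y₂))
    (hx₀ : x₀ = xf - y₀) (hε : 0 < ε)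
    (y : ℝ → ℝ → EuclideanSpace ℝ (Fin 3))
    (hy : ∀ α β : ℝ, y α β = y₀ - (α * L₁) • v - (β * L₂) • w)
    (R : ℝ → ℝ → ℝ)
    (hR : ∀ α β : ℝ, R α β = Real.sqrt (‖xf - y α β‖^2 + ε^2))
    (T : ℕ → ℕ → ℝ → ℝ)
    (hT : ∀ (m n : ℕ) (q : ℝ),
      T m n q = ∫ α in (0:ℝ)..1, ∫ β in (0:ℝ)..α, α ^ m * β ^ n * R α β ^ (-q)) :
    ∀ (m n : ℕ) (q : ℝ),
      (∫ β in (0:ℝ)..1, β ^ n * R 1 β ^ (2 - q)) -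
        (∫ α in (0:ℝ)..1, α ^ (m + n) * R α α ^ (2 - q)) =
      (m : ℝ) * T (m - 1) n (q - 2) -
        (q - 2) * (L₁ * ⟪x₀, v⟫ * T m n q + L₁^2 * T (m + 1) n q +
          L₁ * L₂ * ⟪v, w⟫ * T m (n + 1) q) := by
  intro m n q
  have hL₁0 : L₁ ≠ 0 := by
    rw [hL₁]
    exact norm_ne_zero_iff.2 (sub_ne_zero.2 hy01)
  have hvv : ⟪v, v⟫ = 1 := by
    rw [real_inner_self_eq_norm_sq, hv, norm_smul, ← hL₁, norm_inv, Real.norm_eq_abs, hL₁,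
      abs_norm, ← hL₁, inv_mul_cancel₀ hL₁0, one_pow]
  have hxy : ∀ α β : ℝ, xf - y α β = x₀ + (α * L₁) • v + (β * L₂) • w := by
    intro α β
    rw [hy, hx₀]
    abel
  have hQ_pos : ∀ α β : ℝ, 0 < ‖xf - y α β‖ ^ 2 + ε ^ 2 := fun α β => by positivity
  have hR_pos : ∀ α β : ℝ, 0 < R α β := fun α β => by
    rw [hR]
    exact Real.sqrt_pos.2 (hQ_pos α β)
  have hR_cont : Continuous (Function.uncurry R) := by
    have h : Function.uncurry R = fun p : ℝ × ℝ =>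
        Real.sqrt (‖x₀ + (p.1 * L₁) • v + (p.2 * L₂) • w‖ ^ 2 + ε ^ 2) := by
      ext p
      rw [Function.uncurry, hR, hxy]
    rw [h]
    fun_prop
  have hpow_cont : ∀ (i j : ℕ) (r : ℝ),
      Continuous (Function.uncurry fun α β : ℝ => α ^ i * β ^ j * R α β ^ r) := by
    intro i j r
    have h : Continuous fun p : ℝ × ℝ => Function.uncurry R p ^ r :=
      hR_cont.rpow_const fun p => Or.inl (hR_pos p.1 p.2).ne'
    exact ((continuous_fst.pow i).mul (continuous_snd.pow j)).mul h
  have hR_deriv : ∀ α β : ℝ, HasDerivAt (fun t => R t β ^ (2 - q))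
      ((2 - q) * (L₁ * ⟪x₀, v⟫ + L₁ ^ 2 * α + L₁ * L₂ * ⟪v, w⟫ * β) * R α β ^ (-q)) α := by
    intro α β
    have h_vec : HasDerivAt (fun t : ℝ => x₀ + (t * L₁) • v + (β * L₂) • w) (L₁ • v) α := by
      simpa using ((((hasDerivAt_id α).mul_const L₁).smul_const v).const_add x₀).add_const
        ((β * L₂) • w)
    have h_sqrt := (h_vec.norm_sq.add_const (ε ^ 2)).sqrt (by rw [← hxy]; exact (hQ_pos α β).ne')
    simp_rw [← hxy, ← hR] at h_sqrt
    convert h_sqrt.rpow_const (p := 2 - q) (Or.inl (hR_pos α β).ne') using 1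
    have h_exp : R α β ^ (2 - q - 1) = R α β ^ (-q) * R α β := by
      rw [← Real.rpow_add_one (hR_pos α β).ne']
      ring_nf
    rw [h_exp, hxy]
    simp only [inner_add_left, inner_smul_left, inner_smul_right, hvv, real_inner_comm v w]
    have := (hR_pos α β).ne'
    simp only [conj_trivial]
    field_simp
  have h_deriv : ∀ α β : ℝ, HasDerivAt (fun t => t ^ m * β ^ n * R t β ^ (2 - q))
      (1 * ((m : ℝ) * (α ^ (m - 1) * β ^ n * R α β ^ (2 - q)) +
        (2 - q) * (L₁ * ⟪x₀, v⟫) * (α ^ m * β ^ n * R α β ^ (-q))) +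
      1 * ((2 - q) * L₁ ^ 2 * (α ^ (m + 1) * β ^ n * R α β ^ (-q)) +
        (2 - q) * (L₁ * L₂ * ⟪v, w⟫) * (α ^ m * β ^ (n + 1) * R α β ^ (-q)))) α := by
    intro α β
    exact (((hasDerivAt_pow m α).mul_const (β ^ n)).mul (hR_deriv α β)).congr_deriv (by ring)
  have h_cont : ∀ (a b : ℝ) (i j k l : ℕ) (r s : ℝ), Continuous (Function.uncurry fun α β : ℝ =>
      a * (α ^ i * β ^ j * R α β ^ r) + b * (α ^ k * β ^ l * R α β ^ s)) := fun a b i j k l r s =>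
    ((hpow_cont i j r).const_mul a).add ((hpow_cont k l s).const_mul b)
  have h_main := intervalIntegral_triangle_deriv (hpow_cont m n (2 - q))
    (by exact ((h_cont _ _ _ _ _ _ _ _).const_mul 1).add ((h_cont _ _ _ _ _ _ _ _).const_mul 1))
    h_deriv
  rw [intervalIntegral_triangle_linear (h_cont _ _ _ _ _ _ _ _) (h_cont _ _ _ _ _ _ _ _),
    intervalIntegral_triangle_linear (hpow_cont _ _ _) (hpow_cont _ _ _),
    intervalIntegral_triangle_linear (hpow_cont _ _ _) (hpow_cont _ _ _)] at h_main
  simp only [one_pow, one_mul, ← pow_add] at h_main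
  rw [← h_main, hT, hT, hT, hT, neg_sub]
  ring
end

section
/- With the triangle parameterization and T_{m,n,q} = ∫₀¹ ∫₀^α αᵐ βⁿ R(α,β)^{−q} dβ dα, for all natural numbers m, n and every real q, the following identity holds: ∫₀¹ α^{m+n} R(α,α)^{2−q} dα − [n = 0] ∫₀¹ αᵐ R(α,0)^{2−q} dα = n T_{m,n−1,q−2} − (q−2)[L₂(x₀·ŵ) T_{m,n,q} + L₂² T_{m,n+1,q} + L₁L₂(v̂·ŵ) T_{m+1,n,q}], where [n = 0] equals 1 if n = 0 and 0 otherwise, and for n = 0 the term n T_{m,n−1,q−2} is interpreted as 0. (This is the identity B_{m,n,q−2} = n T_{m,n−1,q−2} − (q−2)(···) obtained by integrating the β-derivative of αᵐβⁿR^{2−q} over the parameter triangle, with the boundary integral B expressed as the line integrals on the left.) -/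
open scoped RealInnerProductSpace

/-- Integrating the `β`-derivative of `αᵐ βⁿ R^{2-q}` over the triangle `0 ≤ β ≤ α ≤ 1`, for a
positive continuous `R` with `∂R/∂β = (A + B β + C α) / R`. -/
theorem triangle_integral_deriv_rpow {R : ℝ → ℝ → ℝ} {A B C : ℝ}
    (hcont : Continuous (Function.uncurry R)) (hpos : ∀ a b, 0 < R a b)
    (hderiv : ∀ a b, HasDerivAt (R a) ((A + B * b + C * a) / R a b) b) (m n : ℕ) (q : ℝ) :
    (∫ α in (0:ℝ)..1, α ^ (m + n) * R α α ^ (2 - q)) -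
        (if n = 0 then (1:ℝ) else 0) * (∫ α in (0:ℝ)..1, α ^ m * R α 0 ^ (2 - q)) =
      (n : ℝ) * (∫ α in (0:ℝ)..1, ∫ β in (0:ℝ)..α, α ^ m * β ^ (n - 1) * R α β ^ (-(q - 2))) -
        (q - 2) *
          (A * (∫ α in (0:ℝ)..1, ∫ β in (0:ℝ)..α, α ^ m * β ^ n * R α β ^ (-q)) +
            B * (∫ α in (0:ℝ)..1, ∫ β in (0:ℝ)..α, α ^ m * β ^ (n + 1) * R α β ^ (-q)) +
            C * (∫ α in (0:ℝ)..1, ∫ β in (0:ℝ)..α, α ^ (m + 1) * β ^ n * R α β ^ (-q))) := by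
  have hRp (p : ℝ) : Continuous fun z : ℝ × ℝ => R z.1 z.2 ^ p :=
    hcont.rpow_const fun z => Or.inl (hpos z.1 z.2).ne'
  have hg (k l : ℕ) (p : ℝ) :
      Continuous (Function.uncurry fun a b : ℝ => a ^ k * b ^ l * R a b ^ p) :=
    ((continuous_fst.pow k).mul (continuous_snd.pow l)).mul (hRp p)
  have hin (k l : ℕ) (p a : ℝ) : IntervalIntegrable (fun b : ℝ => a ^ k * b ^ l * R a b ^ p)
      MeasureTheory.volume 0 a :=
    ((hg k l p).comp (Continuous.prodMk_right a)).intervalIntegrable _ _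
  have hout (k l : ℕ) (p : ℝ) :
      IntervalIntegrable (fun a : ℝ => ∫ b in (0:ℝ)..a, a ^ k * b ^ l * R a b ^ p)
        MeasureTheory.volume 0 1 :=
    (intervalIntegral.continuous_parametric_intervalIntegral_of_continuous (hg k l p)
      continuous_id).intervalIntegrable _ _
  have hline (k : ℕ) (f : ℝ → ℝ) (hf : Continuous f) :
      IntervalIntegrable (fun a : ℝ => a ^ k * R a (f a) ^ (2 - q)) MeasureTheory.volume 0 1 :=
    ((continuous_id.pow k).mul
      ((hRp (2 - q)).comp (continuous_id.prodMk hf))).intervalIntegrable _ _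
  have hdv (a b : ℝ) : HasDerivAt (fun b => a ^ m * b ^ n * R a b ^ (2 - q))
      (n * (a ^ m * b ^ (n - 1) * R a b ^ (-(q - 2))) -
        (q - 2) * (A * (a ^ m * b ^ n * R a b ^ (-q)) +
          B * (a ^ m * b ^ (n + 1) * R a b ^ (-q)) +
          C * (a ^ (m + 1) * b ^ n * R a b ^ (-q)))) b := by
    have h := ((hasDerivAt_pow n b).const_mul (a ^ m)).mul
      ((hderiv a b).rpow_const (p := 2 - q) (Or.inl (hpos a b).ne'))
    refine h.congr_deriv ?_
    have h1 : R a b ^ (2 - q - 1) = R a b ^ (-q) * R a b := by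
      rw [← Real.rpow_add_one (hpos a b).ne']
      ring_nf
    have h2 : -(q - 2) = 2 - q := by ring
    have h3 := (hpos a b).ne'
    rw [h1, h2]
    field_simp
    ring
  have hinner (a : ℝ) :
      a ^ (m + n) * R a a ^ (2 - q) - (if n = 0 then (1:ℝ) else 0) * (a ^ m * R a 0 ^ (2 - q)) =
      n * (∫ b in (0:ℝ)..a, a ^ m * b ^ (n - 1) * R a b ^ (-(q - 2))) -
        (q - 2) * (A * (∫ b in (0:ℝ)..a, a ^ m * b ^ n * R a b ^ (-q)) +
          B * (∫ b in (0:ℝ)..a, a ^ m * b ^ (n + 1) * R a b ^ (-q)) +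
          C * (∫ b in (0:ℝ)..a, a ^ (m + 1) * b ^ n * R a b ^ (-q))) := by
    have i0 := (hin m (n - 1) (-(q - 2)) a).const_mul (n : ℝ)
    have i1 := (hin m n (-q) a).const_mul A
    have i2 := (hin m (n + 1) (-q) a).const_mul B
    have i3 := (hin (m + 1) n (-q) a).const_mul C
    have i4 := ((i1.add i2).add i3).const_mul (q - 2)
    have key := intervalIntegral.integral_eq_sub_of_hasDerivAt (fun b _ => hdv a b) (i0.sub i4)
    rw [intervalIntegral.integral_sub i0 i4, intervalIntegral.integral_const_mul,
      intervalIntegral.integral_const_mul, intervalIntegral.integral_add (i1.add i2) i3,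
      intervalIntegral.integral_add i1 i2, intervalIntegral.integral_const_mul,
      intervalIntegral.integral_const_mul, intervalIntegral.integral_const_mul] at key
    rw [key, pow_add, zero_pow_eq]
    ring
  have o0 := (hout m (n - 1) (-(q - 2))).const_mul (n : ℝ)
  have o1 := (hout m n (-q)).const_mul A
  have o2 := (hout m (n + 1) (-q)).const_mul B
  have o3 := (hout (m + 1) n (-q)).const_mul C
  have o4 := ((o1.add o2).add o3).const_mul (q - 2)
  rw [← intervalIntegral.integral_const_mul, ← intervalIntegral.integral_sub
      (hline (m + n) (fun a => a) continuous_id) ((hline m (fun _ => 0) continuous_const).const_mul _),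
    intervalIntegral.integral_congr fun a _ => hinner a,
    intervalIntegral.integral_sub o0 o4, intervalIntegral.integral_const_mul,
    intervalIntegral.integral_const_mul, intervalIntegral.integral_add (o1.add o2) o3,
    intervalIntegral.integral_add o1 o2, intervalIntegral.integral_const_mul,
    intervalIntegral.integral_const_mul, intervalIntegral.integral_const_mul]

/-- Integrated `β`-derivative identity `B_{m,n,q−2} = n T_{m,n−1,q−2} − (q−2)(···)`
for the triangle integrals `T_{m,n,q}`, with the boundary term written as
line integrals. -/
theorem B_identity_for_T_integrals
    (y₀ y₁ y₂ xf : EuclideanSpace ℝ (Fin 3))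
    (hy01 : y₀ ≠ y₁) (hy12 : y₁ ≠ y₂)
    (L₁ L₂ ε : ℝ) (v w x₀ : EuclideanSpace ℝ (Fin 3))
    (hL₁ : L₁ = ‖y₀ - y₁‖) (hv : v = L₁⁻¹ • (y₀ - y₁))
    (hL₂ : L₂ = ‖y₁ - y₂‖) (hw : w = L₂⁻¹ • (y₁ - y₂))
    (hx₀ : x₀ = xf - y₀) (hε : 0 < ε)
    (y : ℝ → ℝ → EuclideanSpace ℝ (Fin 3))
    (hy : ∀ α β : ℝ, y α β = y₀ - (α * L₁) • v - (β * L₂) • w)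
    (R : ℝ → ℝ → ℝ)
    (hR : ∀ α β : ℝ, R α β = Real.sqrt (‖xf - y α β‖^2 + ε^2))
    (T : ℕ → ℕ → ℝ → ℝ)
    (hT : ∀ (m n : ℕ) (q : ℝ),
      T m n q = ∫ α in (0:ℝ)..1, ∫ β in (0:ℝ)..α, α ^ m * β ^ n * R α β ^ (-q)) :
    ∀ (m n : ℕ) (q : ℝ),
      (∫ α in (0:ℝ)..1, α ^ (m + n) * R α α ^ (2 - q)) -
        (if n = 0 then (1:ℝ) else 0) *
          (∫ α in (0:ℝ)..1, α ^ m * R α 0 ^ (2 - q)) =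
      (n : ℝ) * T m (n - 1) (q - 2) -
        (q - 2) * (L₂ * ⟪x₀, w⟫ * T m n q + L₂^2 * T m (n + 1) q +
          L₁ * L₂ * ⟪v, w⟫ * T (m + 1) n q) := by
  intro m n q
  have hw1 : ⟪w, w⟫ = 1 := by
    rw [real_inner_self_eq_norm_sq, hw, hL₂, norm_smul, norm_inv, norm_norm,
      inv_mul_cancel₀ (norm_ne_zero_iff.mpr (sub_ne_zero.mpr hy12)), one_pow]
  have hRx : R = fun a b => √(‖x₀ + (a * L₁) • v + (b * L₂) • w‖ ^ 2 + ε ^ 2) := by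
    funext a b
    rw [hR, hy, hx₀]
    congr 4
    abel
  have hpos (a b : ℝ) : 0 < R a b := by
    rw [hR]
    positivity
  have hcont : Continuous (Function.uncurry R) := by
    rw [hRx]
    simp only [Function.uncurry_def]
    fun_prop
  have hderiv (a b : ℝ) : HasDerivAt (R a)
      ((L₂ * ⟪x₀, w⟫ + L₂ ^ 2 * b + L₁ * L₂ * ⟪v, w⟫ * a) / R a b) b := by
    have hsmul : HasDerivAt (fun b : ℝ => x₀ + (a * L₁) • v + (b * L₂) • w) (L₂ • w) b := by
      simpa using (((hasDerivAt_id b).mul_const L₂).smul_const w).const_add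
        (x₀ + (a * L₁) • v)
    have hne : ‖x₀ + (a * L₁) • v + (b * L₂) • w‖ ^ 2 + ε ^ 2 ≠ 0 := by positivity
    rw [hRx]
    refine ((hsmul.norm_sq.add_const (ε ^ 2)).sqrt hne).congr_deriv ?_
    rw [mul_div_mul_left _ _ two_ne_zero]
    simp only [inner_add_left, real_inner_smul_left, real_inner_smul_right, hw1]
    ring
  simp only [hT]
  exact triangle_integral_deriv_rpow hcont hpos hderiv m n q
end

section
/- Assume (v̂·ŵ)² ≠ 1 and q ≠ 2. Define A_{m,n,p} = ∫₀¹ βⁿ R(1,β)^{−p} dβ − ∫₀¹ α^{m+n} R(α,α)^{−p} dα and B_{m,n,p} = ∫₀¹ α^{m+n} R(α,α)^{−p} dα − [n = 0] ∫₀¹ αᵐ R(α,0)^{−p} dα. Then the recursion in the first index holds: T_{m+1,n,q} = 1/((v̂·ŵ)² − 1) · [ A_{m,n,q−2}/(L₁²(q−2)) − (v̂·ŵ) B_{m,n,q−2}/(L₁L₂(q−2)) − m T_{m−1,n,q−2}/(L₁²(q−2)) + (v̂·ŵ) n T_{m,n−1,q−2}/(L₁L₂(q−2)) + ((x₀·v̂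 − (v̂·ŵ)(x₀·ŵ))/L₁) T_{m,n,q} ], where terms with factor m (resp. n) are interpreted as 0 when m = 0 (resp. n = 0). -/
open scoped RealInnerProductSpace

open MeasureTheory intervalIntegral in
/-- Fubini's theorem on the triangle `0 ≤ β ≤ α ≤ 1`. -/
theorem integral_triangle_swap {f : ℝ → ℝ → ℝ} (hf : Continuous f.uncurry) :
    ∫ α in (0:ℝ)..1, ∫ β in (0:ℝ)..α, f α β = ∫ β in (0:ℝ)..1, ∫ α in β..1, f α β := by
  have hmeas : MeasurableSet {p : ℝ × ℝ | p.2 ≤ p.1} :=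
    measurableSet_le measurable_snd measurable_fst
  set F : ℝ → ℝ → ℝ := fun α β => {p : ℝ × ℝ | p.2 ≤ p.1}.indicator f.uncurry (α, β) with hF
  have hint : IntegrableOn F.uncurry (Set.uIoc (0:ℝ) 1 ×ˢ Set.uIoc (0:ℝ) 1) := by
    have h : IntegrableOn f.uncurry (Set.uIoc (0:ℝ) 1 ×ˢ Set.uIoc (0:ℝ) 1) :=
      (hf.continuousOn.integrableOn_compact (isCompact_uIcc.prod isCompact_uIcc)).mono_set
        (Set.prod_mono Set.uIoc_subset_uIcc Set.uIoc_subset_uIcc)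
    exact h.indicator hmeas
  calc ∫ α in (0:ℝ)..1, ∫ β in (0:ℝ)..α, f α β
      = ∫ α in (0:ℝ)..1, ∫ β in (0:ℝ)..1, F α β := by
        refine integral_congr fun α hα => ?_
        rw [Set.uIcc_of_le zero_le_one] at hα
        have hind : F α = (Set.Iic α).indicator (f α) := by
          ext β
          simp [hF, Set.indicator_apply]
        simp only [hind, integral_of_le hα.1, integral_of_le zero_le_one]
        rw [setIntegral_indicator measurableSet_Iic, Set.Ioc_inter_Iic, min_eq_right hα.2]
    _ = ∫ β in (0:ℝ)..1, ∫ α in (0:ℝ)..1, F α β := intervalIntegral_intervalIntegral_swap hint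
    _ = ∫ β in (0:ℝ)..1, ∫ α in β..1, f α β := by
        refine integral_congr fun β hβ => ?_
        rw [Set.uIcc_of_le zero_le_one] at hβ
        have hind : (fun α => F α β) = (Set.Ici β).indicator (fun α => f α β) := by
          ext α
          simp [hF, Set.indicator_apply]
        simp only [hind, integral_of_le hβ.2, integral_of_le zero_le_one]
        rw [setIntegral_indicator measurableSet_Ici]
        refine setIntegral_congr_set ?_
        have h := (Filter.EventuallyEq.refl (ae volume) (Set.Ioc (0:ℝ) 1)).inter
          (Ioi_ae_eq_Ici (a := β)).symm
        rwa [Set.Ioc_inter_Ioi, max_eq_right hβ.1] at h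

/-- Integration by parts in the first variable over the triangle `0 ≤ β ≤ α ≤ 1`. -/
theorem integral_triangle_pow_mul_deriv_fst {P P' : ℝ → ℝ → ℝ}
    (hP : Continuous P.uncurry) (hP' : Continuous P'.uncurry)
    (hderiv : ∀ α β, HasDerivAt (fun a => P a β) (P' α β) α) (m n : ℕ) :
    ∫ α in (0:ℝ)..1, ∫ β in (0:ℝ)..α, α ^ m * β ^ n * P' α β =
      (∫ β in (0:ℝ)..1, β ^ n * P 1 β) - (∫ α in (0:ℝ)..1, α ^ (m + n) * P α α) -
        m * ∫ α in (0:ℝ)..1, ∫ β in (0:ℝ)..α, α ^ (m - 1) * β ^ n * P α β := by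
  have hcont (k : ℕ) {Q : ℝ → ℝ → ℝ} (hQ : Continuous Q.uncurry) :
      Continuous (Function.uncurry fun α β : ℝ => α ^ k * β ^ n * Q α β) :=
    ((continuous_fst.pow k).mul (continuous_snd.pow n)).mul hQ
  have hdiag : Continuous fun β => P β β := hP.comp (continuous_id.prodMk continuous_id)
  have hone : Continuous fun β => P 1 β := hP.comp (continuous_const.prodMk continuous_id)
  have hparts (β : ℝ) : ∫ α in β..1, α ^ m * β ^ n * P' α β =
      β ^ n * P 1 β - β ^ (m + n) * P β β - m * ∫ α in β..1, α ^ (m - 1) * β ^ n * P α β := by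
    have h := intervalIntegral.integral_mul_deriv_eq_deriv_mul (a := β) (b := 1)
      (u := fun α => α ^ m * β ^ n) (u' := fun α => m * α ^ (m - 1) * β ^ n)
      (v := fun α => P α β) (v' := fun α => P' α β)
      (fun α _ => (hasDerivAt_pow m α).mul_const _) (fun α _ => hderiv α β)
      (Continuous.intervalIntegrable (by fun_prop) _ _)
      (Continuous.intervalIntegrable (hP'.comp (continuous_id.prodMk continuous_const)) _ _)
    rw [h, ← intervalIntegral.integral_const_mul]
    simp only [one_pow, one_mul, pow_add, mul_assoc]
  have hlast : Continuous fun β : ℝ => ∫ α in β..1, α ^ (m - 1) * β ^ n * P α β := by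
    simp_rw [intervalIntegral.integral_symm (1 : ℝ)]
    exact (intervalIntegral.continuous_parametric_intervalIntegral_of_continuous
      (f := fun β α : ℝ => α ^ (m - 1) * β ^ n * P α β)
      ((hcont (m - 1) hP).comp continuous_swap) continuous_id).neg
  rw [integral_triangle_swap (hcont m hP'), integral_triangle_swap (hcont (m - 1) hP)]
  simp only [hparts]
  rw [intervalIntegral.integral_sub, intervalIntegral.integral_sub,
    intervalIntegral.integral_const_mul]
  all_goals exact Continuous.intervalIntegrable (by fun_prop) _ _

/-- Integration by parts in the second variable over the triangle `0 ≤ β ≤ α ≤ 1`. -/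
theorem integral_triangle_pow_mul_deriv_snd {P P' : ℝ → ℝ → ℝ}
    (hP : Continuous P.uncurry) (hP' : Continuous P'.uncurry)
    (hderiv : ∀ α β, HasDerivAt (fun b => P α b) (P' α β) β) (m n : ℕ) :
    ∫ α in (0:ℝ)..1, ∫ β in (0:ℝ)..α, α ^ m * β ^ n * P' α β =
      (∫ α in (0:ℝ)..1, α ^ (m + n) * P α α) -
        (if n = 0 then (1:ℝ) else 0) * (∫ α in (0:ℝ)..1, α ^ m * P α 0) -
        n * ∫ α in (0:ℝ)..1, ∫ β in (0:ℝ)..α, α ^ m * β ^ (n - 1) * P α β := by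
  have hdiag : Continuous fun α => P α α := hP.comp (continuous_id.prodMk continuous_id)
  have hzero : Continuous fun α => P α 0 := hP.comp (continuous_id.prodMk continuous_const)
  have hparts (α : ℝ) : ∫ β in (0:ℝ)..α, α ^ m * β ^ n * P' α β =
      α ^ (m + n) * P α α - (if n = 0 then (1:ℝ) else 0) * (α ^ m * P α 0) -
        n * ∫ β in (0:ℝ)..α, α ^ m * β ^ (n - 1) * P α β := by
    have h := intervalIntegral.integral_mul_deriv_eq_deriv_mul (a := 0) (b := α)
      (u := fun β => α ^ m * β ^ n) (u' := fun β => α ^ m * (n * β ^ (n - 1)))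
      (v := fun β => P α β) (v' := fun β => P' α β)
      (fun β _ => (hasDerivAt_pow n β).const_mul _) (fun β _ => hderiv α β)
      (Continuous.intervalIntegrable (by fun_prop) _ _)
      (Continuous.intervalIntegrable (hP'.comp (continuous_const.prodMk continuous_id)) _ _)
    rw [h, ← intervalIntegral.integral_const_mul, zero_pow_eq]
    congr 1
    · split_ifs <;> ring
    · congr 1
      ext β
      ring
  have hlast : Continuous fun α : ℝ => ∫ β in (0:ℝ)..α, α ^ m * β ^ (n - 1) * P α β :=
    intervalIntegral.continuous_parametric_intervalIntegral_of_continuous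
      (f := fun α β : ℝ => α ^ m * β ^ (n - 1) * P α β)
      (((continuous_fst.pow m).mul (continuous_snd.pow (n - 1))).mul hP) continuous_id
  simp only [hparts]
  rw [intervalIntegral.integral_sub, intervalIntegral.integral_sub,
    intervalIntegral.integral_const_mul, intervalIntegral.integral_const_mul]
  all_goals exact Continuous.intervalIntegrable (by fun_prop) _ _

/-- Linearity of the integral over the triangle `0 ≤ β ≤ α ≤ 1`. -/
theorem integral_triangle_linear_combination {f g : ℝ → ℝ → ℝ}
    (hf : Continuous f.uncurry) (hg : Continuous g.uncurry) (r s : ℝ) :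
    ∫ α in (0:ℝ)..1, ∫ β in (0:ℝ)..α, (r * f α β + s * g α β) =
      r * (∫ α in (0:ℝ)..1, ∫ β in (0:ℝ)..α, f α β) +
        s * ∫ α in (0:ℝ)..1, ∫ β in (0:ℝ)..α, g α β := by
  have hinner {k : ℝ → ℝ → ℝ} (hk : Continuous k.uncurry) (α : ℝ) : Continuous fun β => k α β :=
    hk.comp (continuous_const.prodMk continuous_id)
  have houter {k : ℝ → ℝ → ℝ} (hk : Continuous k.uncurry) :
      Continuous fun α => ∫ β in (0:ℝ)..α, k α β :=
    intervalIntegral.continuous_parametric_intervalIntegral_of_continuous hk continuous_id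
  have hlin (α : ℝ) : ∫ β in (0:ℝ)..α, (r * f α β + s * g α β) =
      r * (∫ β in (0:ℝ)..α, f α β) + s * ∫ β in (0:ℝ)..α, g α β := by
    rw [intervalIntegral.integral_add (((hinner hf α).const_mul r).intervalIntegrable _ _)
      (((hinner hg α).const_mul s).intervalIntegrable _ _),
      intervalIntegral.integral_const_mul, intervalIntegral.integral_const_mul]
  simp only [hlin]
  rw [intervalIntegral.integral_add (((houter hf).const_mul r).intervalIntegrable _ _)
    (((houter hg).const_mul s).intervalIntegrable _ _),
    intervalIntegral.integral_const_mul, intervalIntegral.integral_const_mul]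

/-- Recursion in the first index for the triangle integrals `T_{m,n,q}`. -/
theorem T_recursion_first_index
    (y₀ y₁ y₂ xf : EuclideanSpace ℝ (Fin 3))
    (hy01 : y₀ ≠ y₁) (hy12 : y₁ ≠ y₂)
    (L₁ L₂ ε : ℝ) (v w x₀ : EuclideanSpace ℝ (Fin 3))
    (hL₁ : L₁ = ‖y₀ - y₁‖) (hv : v = L₁⁻¹ • (y₀ - y₁))
    (hL₂ : L₂ = ‖y₁ - y₂‖) (hw : w = L₂⁻¹ • (y₁ - y₂))
    (hx₀ : x₀ = xf - y₀) (hε : 0 < ε)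
    (y : ℝ → ℝ → EuclideanSpace ℝ (Fin 3))
    (hy : ∀ α β : ℝ, y α β = y₀ - (α * L₁) • v - (β * L₂) • w)
    (R : ℝ → ℝ → ℝ)
    (hR : ∀ α β : ℝ, R α β = Real.sqrt (‖xf - y α β‖^2 + ε^2))
    (T : ℕ → ℕ → ℝ → ℝ)
    (hT : ∀ (m n : ℕ) (q : ℝ),
      T m n q = ∫ α in (0:ℝ)..1, ∫ β in (0:ℝ)..α, α ^ m * β ^ n * R α β ^ (-q))
    (A B : ℕ → ℕ → ℝ → ℝ)
    (hA : ∀ (m n : ℕ) (p : ℝ),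
      A m n p = (∫ β in (0:ℝ)..1, β ^ n * R 1 β ^ (-p)) -
        (∫ α in (0:ℝ)..1, α ^ (m + n) * R α α ^ (-p)))
    (hB : ∀ (m n : ℕ) (p : ℝ),
      B m n p = (∫ α in (0:ℝ)..1, α ^ (m + n) * R α α ^ (-p)) -
        (if n = 0 then (1:ℝ) else 0) * (∫ α in (0:ℝ)..1, α ^ m * R α 0 ^ (-p)))
    (hvw : ⟪v, w⟫^2 ≠ 1) :
    ∀ (m n : ℕ) (q : ℝ), q ≠ 2 →
      T (m + 1) n q = (⟪v, w⟫^2 - 1)⁻¹ *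
        (A m n (q - 2) / (L₁^2 * (q - 2)) -
          ⟪v, w⟫ * B m n (q - 2) / (L₁ * L₂ * (q - 2)) -
          (m : ℝ) * T (m - 1) n (q - 2) / (L₁^2 * (q - 2)) +
          ⟪v, w⟫ * (n : ℝ) * T m (n - 1) (q - 2) / (L₁ * L₂ * (q - 2)) +
          (⟪x₀, v⟫ - ⟪v, w⟫ * ⟪x₀, w⟫) / L₁ * T m n q) := by
  intro m n q hq
  have hL₁0 : L₁ ≠ 0 := by rw [hL₁]; exact norm_ne_zero_iff.2 (sub_ne_zero.2 hy01)
  have hL₂0 : L₂ ≠ 0 := by rw [hL₂]; exact norm_ne_zero_iff.2 (sub_ne_zero.2 hy12)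
  have hunit (z : EuclideanSpace ℝ (Fin 3)) (hz : ‖z‖ ≠ 0) : ⟪‖z‖⁻¹ • z, ‖z‖⁻¹ • z⟫ = 1 := by
    rw [real_inner_smul_left, real_inner_smul_right, real_inner_self_eq_norm_sq]
    field_simp
  have hvv : ⟪v, v⟫ = 1 := by
    rw [hv, hL₁]
    exact hunit _ (hL₁ ▸ hL₁0)
  have hww : ⟪w, w⟫ = 1 := by
    rw [hw, hL₂]
    exact hunit _ (hL₂ ▸ hL₂0)
  set c := ⟪v, w⟫ with hc
  set a := ⟪x₀, v⟫ with ha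
  set b := ⟪x₀, w⟫ with hb
  set S : ℝ → ℝ → ℝ := fun α β => ‖x₀ + (α * L₁) • v + (β * L₂) • w‖ ^ 2 + ε ^ 2 with hS
  have hSexp (α β : ℝ) : S α β = ⟪x₀, x₀⟫ + (α * L₁) ^ 2 + (β * L₂) ^ 2 + 2 * (α * L₁) * a +
      2 * (β * L₂) * b + 2 * (α * L₁) * (β * L₂) * c + ε ^ 2 := by
    simp only [hS]
    rw [← real_inner_self_eq_norm_sq]
    simp only [inner_add_left, inner_add_right, real_inner_smul_left, real_inner_smul_right,
      hvv, hww, real_inner_comm x₀ v, real_inner_comm x₀ w, real_inner_comm v w, ha, hb, hc]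
    ring
  have hSpos (α β : ℝ) : 0 < S α β := by positivity
  have hRS (α β : ℝ) : R α β = √(S α β) := by
    rw [hR, hy, hS, hx₀]
    congr 4
    abel
  have hRpos (α β : ℝ) : 0 < R α β := by rw [hRS]; exact Real.sqrt_pos.2 (hSpos α β)
  have hRcont : Continuous R.uncurry := by
    have : R.uncurry = fun p => √(S p.1 p.2) := funext fun p => hRS p.1 p.2
    rw [this]
    fun_prop
  have hpow (p : ℝ) : Continuous (Function.uncurry fun α β => R α β ^ p) :=
    hRcont.rpow_const fun x => Or.inl (hRpos x.1 x.2).ne'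
  have hderiv {r : ℝ → ℝ} {s t : ℝ} (hr : ∀ x, 0 < r x)
      (hs : HasDerivAt (fun x => r x ^ 2) (2 * s) t) :
      HasDerivAt (fun x => r x ^ (-(q - 2))) (-(q - 2) * s * r t ^ (-q)) t := by
    have h := hs.rpow_const (p := -(q - 2) / 2) (Or.inl (pow_pos (hr t) 2).ne')
    have hsq (x p : ℝ) : (r x ^ 2) ^ p = r x ^ (2 * p) := by
      rw [← Real.rpow_natCast_mul (hr x).le]
      norm_num
    simp only [hsq] at h
    convert h using 1
    · ext x
      congr 1
      ring
    · rw [show 2 * (-(q - 2) / 2 - 1) = -q by ring]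
      ring
  have hRsq (α β : ℝ) : R α β ^ 2 = S α β := by rw [hRS, Real.sq_sqrt (hSpos α β).le]
  have hfst (α β : ℝ) : HasDerivAt (fun x => R x β ^ (-(q - 2)))
      (-(q - 2) * (L₁ * (a + α * L₁ + β * L₂ * c)) * R α β ^ (-q)) α := by
    refine hderiv (fun x => hRpos x β) ?_
    simp only [hRsq, hSexp]
    have h1 := (hasDerivAt_id' α).mul_const L₁
    refine HasDerivAt.congr_deriv ((((((h1.fun_pow 2).const_add ⟪x₀, x₀⟫).add_const _).add
      ((h1.const_mul 2).mul_const a)).add_const _).add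
      (((h1.const_mul 2).mul_const (β * L₂)).mul_const c) |>.add_const _) ?_
    ring
  have hsnd (α β : ℝ) : HasDerivAt (fun x => R α x ^ (-(q - 2)))
      (-(q - 2) * (L₂ * (b + α * L₁ * c + β * L₂)) * R α β ^ (-q)) β := by
    refine hderiv (fun x => hRpos α x) ?_
    simp only [hRsq, hSexp]
    have h1 := (hasDerivAt_id' β).mul_const L₂
    refine HasDerivAt.congr_deriv ((((h1.fun_pow 2).const_add _).add_const _).add
      ((h1.const_mul 2).mul_const b) |>.add
      ((h1.const_mul (2 * (α * L₁))).mul_const c) |>.add_const _) ?_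
    ring
  have hR' (g : ℝ → ℝ → ℝ) (hg : Continuous g.uncurry) :
      Continuous (Function.uncurry fun α β => g α β * R α β ^ (-q)) := hg.mul (hpow (-q))
  have hfst' := hR' (fun α β => -(q - 2) * (L₁ * (a + α * L₁ + β * L₂ * c))) (by fun_prop)
  have hsnd' := hR' (fun α β => -(q - 2) * (L₂ * (b + α * L₁ * c + β * L₂))) (by fun_prop)
  have hmono (k : ℕ) {g : ℝ → ℝ → ℝ} (hg : Continuous g.uncurry) :
      Continuous (Function.uncurry fun α β : ℝ => α ^ k * β ^ n * g α β) :=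
    ((continuous_fst.pow k).mul (continuous_snd.pow n)).mul hg
  have hcomb := integral_triangle_linear_combination (hmono m hfst') (hmono m hsnd') L₂ (-(c * L₁))
  have hT' := integral_triangle_linear_combination (hmono m (hpow (-q))) (hmono (m + 1) (hpow (-q)))
    (-(q - 2) * L₁ * L₂ * (a - c * b)) (-(q - 2) * L₁ * L₂ * (L₁ * (1 - c ^ 2)))
  have hkey := hcomb.symm.trans (Eq.trans (by congr! 4; ring) hT')
  rw [integral_triangle_pow_mul_deriv_fst (hpow (-(q - 2))) hfst' hfst,
    integral_triangle_pow_mul_deriv_snd (hpow (-(q - 2))) hsnd' hsnd, ← hA, ← hB] at hkey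
  simp only [← hT] at hkey
  have hq2 : q - 2 ≠ 0 := sub_ne_zero.2 hq
  have hc2 : c ^ 2 - 1 ≠ 0 := sub_ne_zero.2 hvw
  rw [eq_inv_mul_iff_mul_eq₀ hc2]
  field_simp
  linear_combination -hkey
end

section
/- Let ℓ̂ ∈ ℝ³ be a unit vector, L > 0, y₀, x_f ∈ ℝ³, ε > 0, and set x(θ) = x_f − y₀ + θ L ℓ̂ and R(θ) = √(‖x(θ)‖² + ε²). Then ∫₀¹ R(θ)^{−1} dθ = (1/L) [ artanh( x(1)·ℓ̂ / R(1) ) − artanh( x(0)·ℓ̂ / R(0) ) ], where artanh is the real inverse hyperbolic tangent; the arguments lie in (−1,1) since ε > 0 implies |x(θ)·ℓ̂| < R(θ). -/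
open scoped RealInnerProductSpace

/-- The real inverse hyperbolic tangent. -/
noncomputable def artanh (x : ℝ) : ℝ := (1/2) * Real.log ((1 + x) / (1 - x))

/-- The derivative of `artanh` on `(-1, 1)`. -/
theorem hasDerivAt_artanh {t : ℝ} (ht : |t| < 1) : HasDerivAt artanh (1 - t ^ 2)⁻¹ t := by
  obtain ⟨h₁, h₂⟩ := abs_lt.mp ht
  have hp : 0 < 1 + t := by linarith
  have hm : 0 < 1 - t := by linarith
  have hs : (1 - t ^ 2) ≠ 0 := by nlinarith
  have hquot : HasDerivAt (fun s : ℝ => (1 + s) / (1 - s))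
      ((1 * (1 - t) - (1 + t) * (-1)) / (1 - t) ^ 2) t :=
    ((hasDerivAt_id t).const_add 1).div ((hasDerivAt_id t).const_sub 1) hm.ne'
  refine ((hquot.log (div_pos hp hm).ne').const_mul (1 / 2)).congr_deriv ?_
  field_simp
  ring

theorem abs_lt_sqrt_sq_add {c : ℝ} (hc : 0 < c) (u : ℝ) : |u| < √(u ^ 2 + c) :=
  Real.lt_sqrt_of_sq_lt (by rw [sq_abs]; linarith)

/-- `u ↦ artanh (u / √(u² + c))` is a primitive of `u ↦ 1 / √(u² + c)`. -/
theorem hasDerivAt_artanh_div_sqrt {c : ℝ} (hc : 0 < c) (u : ℝ) :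
    HasDerivAt (fun v : ℝ => artanh (v / √(v ^ 2 + c))) (√(u ^ 2 + c))⁻¹ u := by
  have hpos : 0 < u ^ 2 + c := by positivity
  have hr : 0 < √(u ^ 2 + c) := Real.sqrt_pos.mpr hpos
  have hsq : √(u ^ 2 + c) ^ 2 = u ^ 2 + c := Real.sq_sqrt hpos.le
  have hlt : |u / √(u ^ 2 + c)| < 1 := by
    rw [abs_div, abs_of_pos hr, div_lt_one hr]
    exact abs_lt_sqrt_sq_add hc u
  have hsqrt : HasDerivAt (fun v : ℝ => √(v ^ 2 + c)) (2 * u / (2 * √(u ^ 2 + c))) u := by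
    simpa using (((hasDerivAt_id u).pow 2).add_const c).sqrt hpos.ne'
  have hcomp := (hasDerivAt_artanh hlt).comp u ((hasDerivAt_id u).div hsqrt hr.ne')
  refine hcomp.congr_deriv ?_
  simp only [id]
  have hone : 1 - (u / √(u ^ 2 + c)) ^ 2 = c / √(u ^ 2 + c) ^ 2 := by
    rw [div_pow, hsq]
    field_simp
    ring
  rw [hone]
  generalize √(u ^ 2 + c) = r at hr hsq ⊢
  field_simp
  linarith

/-- Base case `S^ℓ_{0,1}` of the regularized Stokeslet segment integrals:
`∫₀¹ R(θ)⁻¹ dθ = (1/L)[artanh(x(1)·ℓ̂/R(1)) − artanh(x(0)·ℓ̂/R(0))]`. -/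
theorem segment_integral_base_case_S01
    (l y₀ xf : EuclideanSpace ℝ (Fin 3)) (L ε : ℝ)
    (hl : ‖l‖ = 1) (hL : 0 < L) (hε : 0 < ε)
    (x : ℝ → EuclideanSpace ℝ (Fin 3)) (R : ℝ → ℝ)
    (hx : ∀ θ : ℝ, x θ = xf - y₀ + (θ * L) • l)
    (hR : ∀ θ : ℝ, R θ = Real.sqrt (‖x θ‖^2 + ε^2)) :
    (∀ θ : ℝ, |⟪x θ, l⟫| < R θ) ∧
    (∫ θ in (0:ℝ)..1, (R θ)⁻¹) =
      (1 / L) * (artanh (⟪x 1, l⟫ / R 1) - artanh (⟪x 0, l⟫ / R 0)) := by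
  have hinner (θ : ℝ) : ⟪x θ, l⟫ = ⟪xf - y₀, l⟫ + θ * L := by
    rw [hx, inner_add_left, real_inner_smul_left, real_inner_self_eq_norm_sq, hl]
    ring
  have hnorm (θ : ℝ) : ‖x θ‖ ^ 2 = ‖xf - y₀‖ ^ 2 + 2 * (θ * L) * ⟪xf - y₀, l⟫ + (θ * L) ^ 2 := by
    rw [hx, norm_add_sq_real, real_inner_smul_right, norm_smul, hl, mul_one, Real.norm_eq_abs,
      sq_abs]
    ring
  have hcs : ⟪xf - y₀, l⟫ ^ 2 ≤ ‖xf - y₀‖ ^ 2 := by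
    have h := abs_real_inner_le_norm (xf - y₀) l
    rw [hl, mul_one] at h
    exact sq_le_sq.mpr (by rwa [abs_of_nonneg (norm_nonneg (xf - y₀))])
  generalize ⟪xf - y₀, l⟫ = a at hinner hnorm hcs
  obtain ⟨c, hc_eq⟩ : ∃ c, c = ‖xf - y₀‖ ^ 2 - a ^ 2 + ε ^ 2 := ⟨_, rfl⟩
  have hc : 0 < c := by
    have := pow_pos hε 2
    linarith
  have hR' (θ : ℝ) : R θ = √((a + θ * L) ^ 2 + c) := by
    rw [hR, hnorm, hc_eq]
    congr 1
    ring
  refine ⟨fun θ => ?_, ?_⟩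
  · rw [hinner, hR']
    exact abs_lt_sqrt_sq_add hc _
  simp only [hinner, hR']
  have hderiv (θ : ℝ) : HasDerivAt
      (fun t : ℝ => (1 / L) * artanh ((a + t * L) / √((a + t * L) ^ 2 + c)))
      (√((a + θ * L) ^ 2 + c))⁻¹ θ := by
    have hlin : HasDerivAt (fun t : ℝ => a + t * L) L θ := by
      simpa using ((hasDerivAt_id θ).mul_const L).const_add a
    refine (((hasDerivAt_artanh_div_sqrt hc (a + θ * L)).comp θ hlin).const_mul
      (1 / L)).congr_deriv ?_
    field_simp
  have hcont : Continuous fun θ : ℝ => (√((a + θ * L) ^ 2 + c))⁻¹ :=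
    Continuous.inv₀ (by fun_prop) fun θ => (Real.sqrt_pos.mpr (by positivity)).ne'
  rw [intervalIntegral.integral_eq_sub_of_hasDerivAt (fun θ _ => hderiv θ)
    (hcont.intervalIntegrable 0 1), mul_sub]
end

section
/- Let ℓ̂ ∈ ℝ³ be a unit vector, L > 0, y₀, x_f ∈ ℝ³, ε > 0, and set x(θ) = x_f − y₀ + θ L ℓ̂ and R(θ) = √(‖x(θ)‖² + ε²). Then ∫₀¹ R(θ) dθ = (1/(2L)) [ (x(θ)·ℓ̂) R(θ) + (‖x(θ)‖² − (x(θ)·ℓ̂)² + ε²) log( x(θ)·ℓ̂ + R(θ) ) ] evaluated from θ = 0 to θ = 1; the argument of the logarithm is positive since ε > 0 implies R(θ) > |x(θ)·ℓ̂|, and the coefficient ‖x(θ)‖² − (x(θ)·ℓ̂)² is independent of θ. -/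
open scoped RealInnerProductSpace

theorem add_sqrt_sq_add_pos {D : ℝ} (hD : 0 < D) (s : ℝ) : 0 < s + √(s ^ 2 + D) := by
  have h : |s| < √(s ^ 2 + D) := Real.lt_sqrt_of_sq_lt (by rw [sq_abs]; linarith)
  linarith [neg_abs_le s]

theorem hasDerivAt_mul_sqrt_add_mul_log {D : ℝ} (hD : 0 < D) (s : ℝ) :
    HasDerivAt (fun s : ℝ => s * √(s ^ 2 + D) + D * Real.log (s + √(s ^ 2 + D)))
      (2 * √(s ^ 2 + D)) s := by
  have hpos : 0 < s ^ 2 + D := by positivity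
  have hlog := add_sqrt_sq_add_pos hD s
  have hr : 0 < √(s ^ 2 + D) := Real.sqrt_pos.2 hpos
  have hsq : √(s ^ 2 + D) ^ 2 = s ^ 2 + D := Real.sq_sqrt hpos.le
  have hsqrt : HasDerivAt (fun s : ℝ => √(s ^ 2 + D)) (s / √(s ^ 2 + D)) s := by
    convert ((hasDerivAt_pow 2 s).add_const D).sqrt hpos.ne' using 1
    norm_num
    field_simp
  refine (((hasDerivAt_id' s).mul hsqrt).add
    ((((hasDerivAt_id' s).add hsqrt).log hlog.ne').const_mul D)).congr_deriv ?_
  simp only [Pi.add_apply]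
  generalize √(s ^ 2 + D) = r at *
  field_simp
  obtain rfl : D = r ^ 2 - s ^ 2 := by linarith
  ring

theorem integral_sqrt_sq_add {D : ℝ} (hD : 0 < D) (a b : ℝ) :
    ∫ s in a..b, √(s ^ 2 + D) =
      (1 / 2) * ((b * √(b ^ 2 + D) + D * Real.log (b + √(b ^ 2 + D))) -
        (a * √(a ^ 2 + D) + D * Real.log (a + √(a ^ 2 + D)))) := by
  have h := intervalIntegral.integral_eq_sub_of_hasDerivAt
    (fun s _ => hasDerivAt_mul_sqrt_add_mul_log hD s)
    ((by fun_prop : Continuous fun s : ℝ => 2 * √(s ^ 2 + D)).intervalIntegrable a b)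
  rw [intervalIntegral.integral_const_mul] at h
  linarith

/-- Base case `S^ℓ_{0,−1} = ∫₀¹ R dθ` of the regularized Stokeslet segment
integrals, evaluated in closed form. -/
theorem segment_integral_base_case_S0m1
    (l y₀ xf : EuclideanSpace ℝ (Fin 3)) (L ε : ℝ)
    (hl : ‖l‖ = 1) (hL : 0 < L) (hε : 0 < ε)
    (x : ℝ → EuclideanSpace ℝ (Fin 3)) (R : ℝ → ℝ)
    (hx : ∀ θ : ℝ, x θ = xf - y₀ + (θ * L) • l)
    (hR : ∀ θ : ℝ, R θ = Real.sqrt (‖x θ‖^2 + ε^2)) :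
    (∀ θ : ℝ, 0 < ⟪x θ, l⟫ + R θ) ∧
    (∀ θ₁ θ₂ : ℝ, ‖x θ₁‖^2 - ⟪x θ₁, l⟫^2 = ‖x θ₂‖^2 - ⟪x θ₂, l⟫^2) ∧
    (∫ θ in (0:ℝ)..1, R θ) =
      (1 / (2 * L)) *
        ((⟪x 1, l⟫ * R 1 + (‖x 1‖^2 - ⟪x 1, l⟫^2 + ε^2) * Real.log (⟪x 1, l⟫ + R 1)) -
         (⟪x 0, l⟫ * R 0 + (‖x 0‖^2 - ⟪x 0, l⟫^2 + ε^2) * Real.log (⟪x 0, l⟫ + R 0))) := by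
  have hinner (θ : ℝ) : ⟪x θ, l⟫ = ⟪xf - y₀, l⟫ + L * θ := by
    rw [hx, inner_add_left, real_inner_smul_left, real_inner_self_eq_norm_sq, hl]
    ring
  have hcoef (θ : ℝ) : ‖x θ‖ ^ 2 - ⟪x θ, l⟫ ^ 2 = ‖xf - y₀‖ ^ 2 - ⟪xf - y₀, l⟫ ^ 2 := by
    rw [hinner, hx, norm_add_sq_real, real_inner_smul_right, norm_smul, hl, mul_one,
      Real.norm_eq_abs, sq_abs]
    ring
  have hnonneg : 0 ≤ ‖xf - y₀‖ ^ 2 - ⟪xf - y₀, l⟫ ^ 2 := by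
    have h := abs_real_inner_le_norm (xf - y₀) l
    rw [hl, mul_one] at h
    exact sub_nonneg.2 (sq_le_sq.2 (h.trans (le_abs_self _)))
  set D := ‖xf - y₀‖ ^ 2 - ⟪xf - y₀, l⟫ ^ 2 + ε ^ 2 with hDdef
  have hD : 0 < D := by positivity
  have hR' (θ : ℝ) : R θ = √(⟪x θ, l⟫ ^ 2 + D) := by
    rw [hR, hDdef, ← hcoef θ]
    congr 1
    ring
  refine ⟨fun θ => ?_, fun θ₁ θ₂ => by rw [hcoef, hcoef], ?_⟩
  · rw [hR']
    exact add_sqrt_sq_add_pos hD _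
  · have hint : ∫ θ in (0 : ℝ)..1, R θ =
        L⁻¹ * ∫ s in ⟪x 0, l⟫..⟪x 1, l⟫, √(s ^ 2 + D) := by
      simp only [hR', hinner]
      exact intervalIntegral.integral_comp_add_mul (fun s => √(s ^ 2 + D)) hL.ne' _
    rw [hint, integral_sqrt_sq_add hD, hcoef, hcoef, ← hDdef, hR' 0, hR' 1]
    field_simp
end

section
/- Let v₁, v₂, v₃ ∈ ℝ² be vertices of a nondegenerate triangle listed in counterclockwise order (i.e., the determinant of (v₂ − v₁, v₃ − v₁) is positive), let T be their convex hull, let p ∈ ℝ² and γ > 0, and write R(x) = √(‖x − p‖² + γ²). Then the area integral of R^{−3} over T equals the boundary flux of ∇ψ, where ψ(x) = (1/γ) log(R(x) + γ): explicitly, ∫_T (‖x − p‖² + γ²)^{−3/2} dx = Σ_{i=1}^{3} ∫₀¹ ( (v_i + t e_i − p) · n_i ) / ( γ R_i(t) (R_i(t) + γ) ) dt, where e_i = v_{i+1} − v_i (indices mod 3), n_i = ((e_i)_2, −(e_i)_1) is the outward normal to edge i scaled by its length, and R_i(t) = √(‖v_i + t e_i − p‖² + γ²). -/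
open MeasureTheory Set

/-- The flux of the planar vector field `(P, Q)` through the segment from `a` to `b`, with the
normal pointing to the right of the direction of travel. -/
noncomputable def segmentFlux (P Q : ℝ × ℝ → ℝ) (a b : ℝ × ℝ) : ℝ :=
  ∫ t in (0 : ℝ)..1, P (a + t • (b - a)) * (b - a).2 - Q (a + t • (b - a)) * (b - a).1

theorem segmentFlux_symm (P Q : ℝ × ℝ → ℝ) (a b : ℝ × ℝ) :
    segmentFlux P Q a b = -segmentFlux P Q b a := by
  have h := intervalIntegral.integral_comp_sub_left (a := 0) (b := 1)
    (fun t : ℝ => P (a + t • (b - a)) * (b - a).2 - Q (a + t • (b - a)) * (b - a).1) 1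
  simp only [sub_self, sub_zero] at h
  rw [segmentFlux, segmentFlux, ← h, ← intervalIntegral.integral_neg]
  refine intervalIntegral.integral_congr fun t _ => ?_
  have e : a + (1 - t) • (b - a) = b + t • (a - b) := by module
  simp only [e, Prod.fst_sub, Prod.snd_sub]
  ring

/-- The Duffy map, sending the unit square onto the triangle with vertices `a`, `b`, `c` and
collapsing the side `z.1 = 0` to the vertex `a`. -/
def duffyMap (a b c z : ℝ × ℝ) : ℝ × ℝ :=
  a + z.1 • (b - a + z.2 • (c - b))

/-- The derivative of the Duffy map. -/
noncomputable def duffyMapFDeriv (a b c z : ℝ × ℝ) : ℝ × ℝ →L[ℝ] ℝ × ℝ :=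
  (Matrix.toLin (.finTwoProd ℝ) (.finTwoProd ℝ)
    !![(b - a).1 + z.2 * (c - b).1, z.1 * (c - b).1;
      (b - a).2 + z.2 * (c - b).2, z.1 * (c - b).2]).toContinuousLinearMap

theorem duffyMapFDeriv_apply (a b c z w : ℝ × ℝ) :
    duffyMapFDeriv a b c z w =
      (((b - a).1 + z.2 * (c - b).1) * w.1 + z.1 * (c - b).1 * w.2,
        ((b - a).2 + z.2 * (c - b).2) * w.1 + z.1 * (c - b).2 * w.2) := by
  simp [duffyMapFDeriv, Matrix.toLin_finTwoProd_apply]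

theorem hasFDerivAt_duffyMap (a b c z : ℝ × ℝ) :
    HasFDerivAt (duffyMap a b c) (duffyMapFDeriv a b c z) z := by
  have h := ((hasFDerivAt_fst (𝕜 := ℝ) (p := z)).smul
    (((hasFDerivAt_snd (𝕜 := ℝ) (p := z)).smul_const (c - b)).const_add (b - a))).const_add a
  refine h.congr_fderiv (ContinuousLinearMap.ext fun w => ?_)
  rw [duffyMapFDeriv_apply]
  ext <;> simp <;> ring

theorem det_duffyMapFDeriv (a b c z : ℝ × ℝ) :
    (duffyMapFDeriv a b c z).det =
      z.1 * ((b.1 - a.1) * (c.2 - a.2) - (b.2 - a.2) * (c.1 - a.1)) := by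
  simp only [duffyMapFDeriv, LinearMap.det_toContinuousLinearMap, LinearMap.det_toLin,
    Matrix.det_fin_two_of, Prod.fst_sub, Prod.snd_sub]
  ring

theorem continuous_duffyMap (a b c : ℝ × ℝ) : Continuous (duffyMap a b c) := by
  unfold duffyMap; fun_prop

theorem injOn_duffyMap {a b c : ℝ × ℝ}
    (h : (b.1 - a.1) * (c.2 - a.2) - (b.2 - a.2) * (c.1 - a.1) ≠ 0) :
    InjOn (duffyMap a b c) (Ioc 0 1 ×ˢ Icc 0 1) := by
  rintro ⟨s, t⟩ ⟨⟨hs, -⟩, -⟩ ⟨s', t'⟩ - he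
  simp only [duffyMap, Prod.ext_iff, Prod.fst_add, Prod.snd_add, Prod.smul_fst, Prod.smul_snd,
    Prod.fst_sub, Prod.snd_sub, smul_eq_mul] at he
  obtain ⟨h1, h2⟩ := he
  have hss : s = s' := mul_right_cancel₀ h (by
    linear_combination (c.2 - b.2) * h1 - (c.1 - b.1) * h2)
  subst hss
  have htt : s * t = s * t' := mul_right_cancel₀ h (by
    linear_combination (b.1 - a.1) * h2 - (b.2 - a.2) * h1)
  rw [mul_left_cancel₀ (ne_of_gt hs) htt]

theorem image_duffyMap {a b c : ℝ × ℝ}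
    (h : (b.1 - a.1) * (c.2 - a.2) - (b.2 - a.2) * (c.1 - a.1) ≠ 0) :
    duffyMap a b c '' (Ioc 0 1 ×ˢ Icc 0 1) = convexHull ℝ {a, b, c} \ {a} := by
  have key : ∀ x, x ∈ convexHull ℝ {a, b, c} ↔
      ∃ z ∈ Icc (0 : ℝ) 1 ×ˢ Icc (0 : ℝ) 1, duffyMap a b c z = x := by
    intro x
    rw [convexHull_insert (by simp), convexHull_pair, convexJoin_singleton_left]
    simp only [segment_eq_image', mem_iUnion, mem_image, exists_prop, duffyMap]
    constructor
    · rintro ⟨_, ⟨t, ht, rfl⟩, s, hs, rfl⟩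
      exact ⟨(s, t), ⟨hs, ht⟩, by dsimp only; module⟩
    · rintro ⟨⟨s, t⟩, ⟨hs, ht⟩, rfl⟩
      exact ⟨_, ⟨t, ht, rfl⟩, s, hs, by dsimp only; module⟩
  ext x
  rw [mem_sdiff, key, mem_singleton_iff]
  constructor
  · rintro ⟨⟨s, t⟩, ⟨hs, ht⟩, rfl⟩
    refine ⟨⟨(s, t), ⟨Ioc_subset_Icc_self hs, ht⟩, rfl⟩, fun he => ?_⟩
    simp only [duffyMap, Prod.ext_iff, Prod.fst_add, Prod.snd_add, Prod.smul_fst, Prod.smul_snd,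
      Prod.fst_sub, Prod.snd_sub, smul_eq_mul] at he
    obtain ⟨h1, h2⟩ := he
    refine mul_ne_zero hs.1.ne' h ?_
    linear_combination (c.2 - b.2) * h1 - (c.1 - b.1) * h2
  · rintro ⟨⟨⟨s, t⟩, ⟨hs, ht⟩, rfl⟩, hx⟩
    refine ⟨(s, t), ⟨⟨lt_of_le_of_ne hs.1 ?_, hs.2⟩, ht⟩, rfl⟩
    rintro rfl
    exact hx (by simp [duffyMap])

/-- Integration over a positively oriented triangle in Duffy coordinates. -/
theorem setIntegral_convexHull_triple_eq {a b c : ℝ × ℝ}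
    (h : 0 < (b.1 - a.1) * (c.2 - a.2) - (b.2 - a.2) * (c.1 - a.1)) (g : ℝ × ℝ → ℝ) :
    ∫ x in convexHull ℝ {a, b, c}, g x =
      ∫ z in Icc ((0 : ℝ), (0 : ℝ)) (1, 1),
        z.1 * ((b.1 - a.1) * (c.2 - a.2) - (b.2 - a.2) * (c.1 - a.1)) *
          g (duffyMap a b c z) := by
  have hm : MeasurableSet (Ioc (0 : ℝ) 1 ×ˢ Icc (0 : ℝ) 1) :=
    measurableSet_Ioc.prod measurableSet_Icc
  rw [← setIntegral_congr_set (sdiff_null_ae_eq_self (measure_singleton a)),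
    ← image_duffyMap h.ne', integral_image_eq_integral_abs_det_fderiv_smul volume hm
      (fun z _ => (hasFDerivAt_duffyMap a b c z).hasFDerivWithinAt) (injOn_duffyMap h.ne'),
    ← Icc_prod_Icc]
  have hae : (Icc (0 : ℝ) 1 ×ˢ Icc (0 : ℝ) 1 : Set (ℝ × ℝ)) =ᵐ[volume]
      Ioc (0 : ℝ) 1 ×ˢ Icc (0 : ℝ) 1 :=
    Measure.set_prod_ae_eq Ioc_ae_eq_Icc.symm ae_eq_rfl
  rw [setIntegral_congr_set hae]
  refine setIntegral_congr_fun hm fun z hz => ?_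
  simp only [det_duffyMapFDeriv, smul_eq_mul]
  rw [abs_of_pos (mul_pos hz.1.1 h)]

/-- The divergence theorem on a positively oriented triangle. -/
theorem setIntegral_divergence_convexHull_triple {P Q : ℝ × ℝ → ℝ}
    {P' Q' : ℝ × ℝ → ℝ × ℝ →L[ℝ] ℝ} (hP : ∀ x, HasFDerivAt P (P' x) x)
    (hQ : ∀ x, HasFDerivAt Q (Q' x) x) (hdiv : Continuous fun x => P' x (1, 0) + Q' x (0, 1))
    {a b c : ℝ × ℝ} (h : 0 < (b.1 - a.1) * (c.2 - a.2) - (b.2 - a.2) * (c.1 - a.1)) :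
    ∫ x in convexHull ℝ {a, b, c}, (P' x (1, 0) + Q' x (0, 1)) =
      segmentFlux P Q a b + segmentFlux P Q b c + segmentFlux P Q c a := by
  rw [setIntegral_convexHull_triple_eq h]
  have hΦ := hasFDerivAt_duffyMap a b c
  have hPc : Continuous P := continuous_iff_continuousAt.2 fun x => (hP x).continuousAt
  have hQc : Continuous Q := continuous_iff_continuousAt.2 fun x => (hQ x).continuousAt
  have hΦc := continuous_duffyMap a b c
  have hPΦ z := (hP (duffyMap a b c z)).comp z (hΦ z)
  have hQΦ z := (hQ (duffyMap a b c z)).comp z (hΦ z)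
  have hlinear (L : ℝ × ℝ →L[ℝ] ℝ) (x y : ℝ) : L (x, y) = x * L (1, 0) + y * L (0, 1) := by
    rw [← smul_eq_mul, ← smul_eq_mul, ← map_smul, ← map_smul, ← map_add]
    simp
  obtain ⟨f', hf, hf'⟩ : ∃ f' : ℝ × ℝ → ℝ × ℝ →L[ℝ] ℝ,
      (∀ z, HasFDerivAt (fun z : ℝ × ℝ => z.1 *
        (P (duffyMap a b c z) * (c - b).2 - Q (duffyMap a b c z) * (c - b).1)) (f' z) z) ∧
      ∀ z, f' z (1, 0) = P (duffyMap a b c z) * (c - b).2 - Q (duffyMap a b c z) * (c - b).1 +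
        z.1 * (P' (duffyMap a b c z) (duffyMapFDeriv a b c z (1, 0)) * (c - b).2 -
          Q' (duffyMap a b c z) (duffyMapFDeriv a b c z (1, 0)) * (c - b).1) := by
    refine ⟨_, fun z => hasFDerivAt_fst.mul
      (((hPΦ z).mul_const (c - b).2).sub ((hQΦ z).mul_const (c - b).1)), fun z => ?_⟩
    simp
    ring
  obtain ⟨g', hg, hg'⟩ : ∃ g' : ℝ × ℝ → ℝ × ℝ →L[ℝ] ℝ,
      (∀ z, HasFDerivAt (fun z : ℝ × ℝ =>
        Q (duffyMap a b c z) * ((b - a).1 + z.2 * (c - b).1) -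
          P (duffyMap a b c z) * ((b - a).2 + z.2 * (c - b).2)) (g' z) z) ∧
      ∀ z, g' z (0, 1) = Q (duffyMap a b c z) * (c - b).1 - P (duffyMap a b c z) * (c - b).2 +
        Q' (duffyMap a b c z) (duffyMapFDeriv a b c z (0, 1)) * ((b - a).1 + z.2 * (c - b).1) -
        P' (duffyMap a b c z) (duffyMapFDeriv a b c z (0, 1)) *
          ((b - a).2 + z.2 * (c - b).2) := by
    refine ⟨_, fun z =>
      ((hQΦ z).mul ((hasFDerivAt_snd.mul_const (c - b).1).const_add (b - a).1)).sub
        ((hPΦ z).mul ((hasFDerivAt_snd.mul_const (c - b).2).const_add (b - a).2)), fun z => ?_⟩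
    simp
    ring
  have hpull (z : ℝ × ℝ) :
      z.1 * ((b.1 - a.1) * (c.2 - a.2) - (b.2 - a.2) * (c.1 - a.1)) *
        (P' (duffyMap a b c z) (1, 0) + Q' (duffyMap a b c z) (0, 1)) =
      f' z (1, 0) + g' z (0, 1) := by
    rw [hf', hg', duffyMapFDeriv_apply, duffyMapFDeriv_apply, hlinear (P' _) (_ + _),
      hlinear (P' _) (_ + _), hlinear (Q' _) (_ + _), hlinear (Q' _) (_ + _)]
    simp only [Prod.fst_sub, Prod.snd_sub]
    ring
  have hint : IntegrableOn (fun z => f' z (1, 0) + g' z (0, 1))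
      (Icc ((0 : ℝ), (0 : ℝ)) (1, 1)) := by
    simp only [← hpull]
    have hJ : Continuous fun z : ℝ × ℝ =>
      z.1 * ((b.1 - a.1) * (c.2 - a.2) - (b.2 - a.2) * (c.1 - a.1)) := by fun_prop
    exact (hJ.mul (hdiv.comp hΦc)).continuousOn.integrableOn_compact isCompact_Icc
  simp only [hpull]
  rw [integral_divergence_prod_Icc_of_hasFDerivAt_of_le _ _ f' g' (0, 0) (1, 1)
    ⟨zero_le_one, zero_le_one⟩ (by fun_prop) (by fun_prop) (fun z _ => hf z) (fun z _ => hg z) hint,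
    segmentFlux_symm P Q c a]
  have hab : segmentFlux P Q a b = -∫ s in (0 : ℝ)..1,
      (Q (duffyMap a b c (s, 0)) * ((b - a).1 + 0 * (c - b).1) -
        P (duffyMap a b c (s, 0)) * ((b - a).2 + 0 * (c - b).2)) := by
    rw [segmentFlux, ← intervalIntegral.integral_neg]
    refine intervalIntegral.integral_congr fun s _ => ?_
    simp [duffyMap]
  have hac : segmentFlux P Q a c = -∫ s in (0 : ℝ)..1,
      (Q (duffyMap a b c (s, 1)) * ((b - a).1 + 1 * (c - b).1) -
        P (duffyMap a b c (s, 1)) * ((b - a).2 + 1 * (c - b).2)) := by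
    rw [segmentFlux, ← intervalIntegral.integral_neg]
    refine intervalIntegral.integral_congr fun s _ => ?_
    simp [duffyMap]
  have hbc : segmentFlux P Q b c = ∫ t in (0 : ℝ)..1, 1 *
      (P (duffyMap a b c (1, t)) * (c - b).2 - Q (duffyMap a b c (1, t)) * (c - b).1) := by
    refine intervalIntegral.integral_congr fun t _ => ?_
    have : duffyMap a b c (1, t) = b + t • (c - b) := by simp only [duffyMap]; module
    simp only [this, one_mul]
  rw [hab, hac, hbc]
  simp only [zero_mul, intervalIntegral.integral_zero]
  ring

/-- The regularized distance `√(‖x - p‖² + γ²)` in the plane. -/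
noncomputable def regDist (p : ℝ × ℝ) (γ : ℝ) (x : ℝ × ℝ) : ℝ :=
  √((x.1 - p.1) ^ 2 + (x.2 - p.2) ^ 2 + γ ^ 2)

theorem regDist_pos (p : ℝ × ℝ) {γ : ℝ} (hγ : 0 < γ) (x : ℝ × ℝ) : 0 < regDist p γ x := by
  unfold regDist; positivity

theorem sq_regDist (p : ℝ × ℝ) (γ : ℝ) (x : ℝ × ℝ) :
    regDist p γ x ^ 2 = (x.1 - p.1) ^ 2 + (x.2 - p.2) ^ 2 + γ ^ 2 :=
  Real.sq_sqrt (by positivity)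

theorem regDist_rpow (p : ℝ × ℝ) {γ : ℝ} (hγ : 0 < γ) (x : ℝ × ℝ) :
    ((x.1 - p.1) ^ 2 + (x.2 - p.2) ^ 2 + γ ^ 2) ^ (-(3 : ℝ) / 2) = (regDist p γ x ^ 3)⁻¹ := by
  rw [← sq_regDist, ← Real.rpow_natCast, ← Real.rpow_mul (regDist_pos p hγ x).le,
    ← Real.rpow_natCast, ← Real.rpow_neg (regDist_pos p hγ x).le]
  norm_num

theorem continuous_regDist (p : ℝ × ℝ) (γ : ℝ) : Continuous (regDist p γ) := by
  unfold regDist; fun_prop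

theorem hasFDerivAt_regDist (p : ℝ × ℝ) {γ : ℝ} (hγ : 0 < γ) (x : ℝ × ℝ) :
    HasFDerivAt (regDist p γ) ((regDist p γ x)⁻¹ •
      ((x.1 - p.1) • ContinuousLinearMap.fst ℝ ℝ ℝ +
        (x.2 - p.2) • ContinuousLinearMap.snd ℝ ℝ ℝ)) x := by
  have h1 := ((hasFDerivAt_fst (𝕜 := ℝ) (p := x)).sub_const p.1).pow 2
  have h2 := ((hasFDerivAt_snd (𝕜 := ℝ) (p := x)).sub_const p.2).pow 2
  have h := ((h1.add h2).add_const (γ ^ 2)).sqrt (by simp; positivity)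
  refine h.congr_fderiv (ContinuousLinearMap.ext fun w => ?_)
  simp [regDist]
  field_simp

/-- The vector field `∇ψ` has divergence `R⁻³`. -/
theorem exists_hasFDerivAt_divergence_eq (p : ℝ × ℝ) {γ : ℝ} (hγ : 0 < γ) :
    ∃ P' Q' : ℝ × ℝ → ℝ × ℝ →L[ℝ] ℝ,
      (∀ x, HasFDerivAt (fun x : ℝ × ℝ =>
        (x.1 - p.1) * (γ * regDist p γ x * (regDist p γ x + γ))⁻¹) (P' x) x) ∧
      (∀ x, HasFDerivAt (fun x : ℝ × ℝ =>
        (x.2 - p.2) * (γ * regDist p γ x * (regDist p γ x + γ))⁻¹) (Q' x) x) ∧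
      ∀ x, P' x (1, 0) + Q' x (0, 1) = (regDist p γ x ^ 3)⁻¹ := by
  have hR x := regDist_pos p hγ x
  have hH x := (hasDerivAt_inv (by have := hR x; positivity :
    γ * regDist p γ x * (regDist p γ x + γ) ≠ 0)).comp_hasFDerivAt x
      (((hasFDerivAt_regDist p hγ x).const_mul γ).mul ((hasFDerivAt_regDist p hγ x).add_const γ))
  refine ⟨_, _, fun x => (hasFDerivAt_fst.sub_const p.1).mul (hH x),
    fun x => (hasFDerivAt_snd.sub_const p.2).mul (hH x), fun x => ?_⟩
  have h := hR x
  have hs := sq_regDist p γ x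
  simp
  generalize regDist p γ x = r at *
  generalize x.2 - p.2 = v at *
  generalize x.1 - p.1 = u at *
  field_simp
  linear_combination (2 * r + γ) * hs

/-- Green's first identity over a planar triangle for the base-case integral
`T₀₀₃`: the area integral of `R⁻³` equals the boundary flux of `∇ψ`,
`ψ = (1/γ) log(R + γ)`, written as a sum of three edge integrals. -/
theorem green_identity_T003
    (v1 v2 v3 p : ℝ × ℝ) (γ : ℝ) (hγ : 0 < γ)
    (hccw : 0 < (v2.1 - v1.1) * (v3.2 - v1.2) - (v2.2 - v1.2) * (v3.1 - v1.1))
    (V : Fin 3 → ℝ × ℝ) (hV0 : V 0 = v1) (hV1 : V 1 = v2) (hV2 : V 2 = v3)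
    (e n : Fin 3 → ℝ × ℝ)
    (he : ∀ i, e i = V (i + 1) - V i)
    (hn : ∀ i, n i = ((e i).2, -(e i).1))
    (R : Fin 3 → ℝ → ℝ)
    (hRi : ∀ i t, R i t =
      Real.sqrt (((V i).1 + t * (e i).1 - p.1)^2 +
        ((V i).2 + t * (e i).2 - p.2)^2 + γ^2)) :
    (∫ x in convexHull ℝ {v1, v2, v3},
        ((x.1 - p.1)^2 + (x.2 - p.2)^2 + γ^2) ^ (-(3:ℝ)/2)) =
    ∑ i : Fin 3, ∫ t in (0:ℝ)..1,
      (((V i).1 + t * (e i).1 - p.1) * (n i).1 +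
        ((V i).2 + t * (e i).2 - p.2) * (n i).2) /
        (γ * R i t * (R i t + γ)) := by
  have hR (i : Fin 3) (t : ℝ) : R i t = regDist p γ (V i + t • e i) := by
    simp [hRi, regDist]
  obtain ⟨P', Q', hP, hQ, hdiv⟩ := exists_hasFDerivAt_divergence_eq p hγ
  have hc : Continuous fun x => P' x (1, 0) + Q' x (0, 1) := by
    simp only [hdiv]
    exact ((continuous_regDist p γ).pow 3).inv₀ fun x => (pow_pos (regDist_pos p hγ x) 3).ne'
  have key := setIntegral_divergence_convexHull_triple hP hQ hc hccw
  simp only [hdiv] at key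
  simp only [regDist_rpow p hγ, key, Fin.sum_univ_three, segmentFlux, hR, hn, he]
  simp only [zero_add, Fin.reduceAdd, hV0, hV1, hV2]
  congr 1
  · congr 1 <;>
    · refine intervalIntegral.integral_congr fun t _ => ?_
      simp only [Prod.fst_add, Prod.snd_add, Prod.smul_fst, Prod.smul_snd, smul_eq_mul,
        div_eq_mul_inv]
      ring
  · refine intervalIntegral.integral_congr fun t _ => ?_
    simp only [Prod.fst_add, Prod.snd_add, Prod.smul_fst, Prod.smul_snd, smul_eq_mul,
      div_eq_mul_inv]
    ring
end

section
/- Let P ∈ ℝ and 0 < c < Q. Then ∫₀¹ dα / [ √((α + P)² + Q²) · ( √((α + P)² + Q²) + c ) ] = (2/√(Q² − c²)) · [ arctan( √((Q − c)/(Q + c)) · (1 + P)/( Q + √((1 + P)² + Q²) ) ) − arctan( √((Q − c)/(Q + c)) · P/( Q + √(P² + Q²) ) ) ]. (This single closed form is equivalent to the case-split evaluations for P ≥ 0, P ≤ −1, and −1 < P < 0 used in the computation of the base-case integral T_{0,0,3}.) -/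
theorem hasDerivAt_div_add_sqrt_sq_add_sq {Q : ℝ} (hQ : 0 < Q) (x : ℝ) :
    HasDerivAt (fun y : ℝ => y / (Q + Real.sqrt (y ^ 2 + Q ^ 2)))
      (Q / (Real.sqrt (x ^ 2 + Q ^ 2) * (Q + Real.sqrt (x ^ 2 + Q ^ 2)))) x := by
  have hpos : 0 < x ^ 2 + Q ^ 2 := by positivity
  have hR : 0 < Real.sqrt (x ^ 2 + Q ^ 2) := Real.sqrt_pos.2 hpos
  have hsq : Real.sqrt (x ^ 2 + Q ^ 2) ^ 2 = x ^ 2 + Q ^ 2 := Real.sq_sqrt hpos.le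
  have hsqrt := (((hasDerivAt_pow 2 x).add_const (Q ^ 2)).sqrt hpos.ne').const_add Q
  refine ((hasDerivAt_id' x).div hsqrt (by positivity)).congr_deriv ?_
  generalize Real.sqrt (x ^ 2 + Q ^ 2) = R at *
  field_simp
  push_cast
  linear_combination 2 * hsq

theorem sqrt_sub_div_add {c Q : ℝ} (h : 0 < Q + c) :
    Real.sqrt ((Q - c) / (Q + c)) = Real.sqrt (Q ^ 2 - c ^ 2) / (Q + c) := by
  have : (Q - c) / (Q + c) = (Q ^ 2 - c ^ 2) / (Q + c) ^ 2 := by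
    field_simp
    ring
  rw [this, Real.sqrt_div' _ (sq_nonneg _), Real.sqrt_sq h.le]

theorem hasDerivAt_arctan_sqrt_mul_div_add_sqrt {c Q : ℝ} (hc : 0 < c) (hcQ : c < Q) (x : ℝ) :
    HasDerivAt
      (fun y : ℝ => (2 / Real.sqrt (Q ^ 2 - c ^ 2)) *
        Real.arctan (Real.sqrt ((Q - c) / (Q + c)) * (y / (Q + Real.sqrt (y ^ 2 + Q ^ 2)))))
      (1 / (Real.sqrt (x ^ 2 + Q ^ 2) * (Real.sqrt (x ^ 2 + Q ^ 2) + c))) x := by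
  have hQ : 0 < Q := hc.trans hcQ
  have hpos : 0 < x ^ 2 + Q ^ 2 := by positivity
  have hR : 0 < Real.sqrt (x ^ 2 + Q ^ 2) := Real.sqrt_pos.2 hpos
  have hRsq : Real.sqrt (x ^ 2 + Q ^ 2) ^ 2 = x ^ 2 + Q ^ 2 := Real.sq_sqrt hpos.le
  have hdiff : 0 < Q ^ 2 - c ^ 2 := by nlinarith
  have hs : 0 < Real.sqrt (Q ^ 2 - c ^ 2) := Real.sqrt_pos.2 hdiff
  have hssq : Real.sqrt (Q ^ 2 - c ^ 2) ^ 2 = Q ^ 2 - c ^ 2 := Real.sq_sqrt hdiff.le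
  refine ((((hasDerivAt_div_add_sqrt_sq_add_sq hQ x).const_mul _).arctan).const_mul _).congr_deriv ?_
  rw [sqrt_sub_div_add (by positivity : 0 < Q + c)]
  generalize Real.sqrt (x ^ 2 + Q ^ 2) = R at *
  generalize Real.sqrt (Q ^ 2 - c ^ 2) = s at *
  have hden : 1 + (s / (Q + c) * (x / (Q + R))) ^ 2 =
      2 * Q * (R + c) / ((Q + c) * (Q + R)) := by
    have hx : x ^ 2 = R ^ 2 - Q ^ 2 := by linarith
    rw [mul_pow, div_pow, div_pow, hssq, hx]
    field_simp
    ring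
  rw [hden]
  field_simp

/-- Closed form for the side integral appearing in the base case `T₀₀₃` of the
regularized Stokeslet surface method. -/
theorem side_integral_closed_form (P c Q : ℝ) (hc : 0 < c) (hcQ : c < Q) :
    (∫ α in (0:ℝ)..1,
        1 / (Real.sqrt ((α + P)^2 + Q^2) * (Real.sqrt ((α + P)^2 + Q^2) + c))) =
      (2 / Real.sqrt (Q^2 - c^2)) *
        (Real.arctan (Real.sqrt ((Q - c) / (Q + c)) *
            ((1 + P) / (Q + Real.sqrt ((1 + P)^2 + Q^2)))) -
         Real.arctan (Real.sqrt ((Q - c) / (Q + c)) *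
            (P / (Q + Real.sqrt (P^2 + Q^2))))) := by
  have hQ : 0 < Q := hc.trans hcQ
  have hcont : Continuous fun x : ℝ =>
      1 / (Real.sqrt (x ^ 2 + Q ^ 2) * (Real.sqrt (x ^ 2 + Q ^ 2) + c)) :=
    continuous_const.div (by fun_prop) fun x => by positivity
  rw [intervalIntegral.integral_comp_add_right
    (fun x : ℝ => 1 / (Real.sqrt (x ^ 2 + Q ^ 2) * (Real.sqrt (x ^ 2 + Q ^ 2) + c))) P,
    intervalIntegral.integral_eq_sub_of_hasDerivAt
      (fun x _ => hasDerivAt_arctan_sqrt_mul_div_add_sqrt hc hcQ x)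
      (hcont.intervalIntegrable _ _), zero_add, mul_sub]
end

section
/- With the triangle parameterization, the linear force density f(α,β) = f₀ + α f_a + β f_b, the regularized Stokeslet kernel S^ε, T_{m,n,q} = ∫₀¹ ∫₀^α αᵐ βⁿ R(α,β)^{−q} dβ dα, and the constant vectors P_{i,j} of the kernel expansion, the exact velocity formula holds: ∫₀¹ ∫₀^α S^ε(x_f, y(α,β))·f(α,β) dβ dα = f₀ T_{0,0,1} + P₀₀ T_{0,0,3} + f_a T_{1,0,1} + P₁₀ T_{1,0,3} + f_b T_{0,1,1} + P₀₁ T_{0,1,3} + P₂₀ T_{2,0,3} + P₁₁ T_{1,1,3} + P₀₂ T_{0,2,3} + P₃₀ T_{3,0,3} + P₂₁ T_{2,1,3} + P₁₂ T_{1,2,3} + P₀₃ T_{0,3,3}. Consequently (8πμ/BH) u(x_f) equals the right-hand side, where u is the regularized velocity due to the linear force density over the triangle. -/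
open scoped RealInnerProductSpace

/-- The iterated integral over the reference triangle commutes with finite linear combinations
of constant vectors whose coefficients are continuous functions. -/
theorem integral_triangle_sum_smul_const {ι E : Type*} [NormedAddCommGroup E] [NormedSpace ℝ E]
    [CompleteSpace E] (s : Finset ι) (a : ι → ℝ → ℝ → ℝ)
    (ha : ∀ i, Continuous (Function.uncurry (a i))) (p : ι → E) :
    (∫ α in (0:ℝ)..1, ∫ β in (0:ℝ)..α, ∑ i ∈ s, a i α β • p i) =
      ∑ i ∈ s, (∫ α in (0:ℝ)..1, ∫ β in (0:ℝ)..α, a i α β) • p i := by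
  have inner_eq (α : ℝ) : (∫ β in (0:ℝ)..α, ∑ i ∈ s, a i α β • p i) =
      ∑ i ∈ s, (∫ β in (0:ℝ)..α, a i α β) • p i := by
    rw [intervalIntegral.integral_finsetSum]
    · simp only [intervalIntegral.integral_smul_const]
    · exact fun i _ => (((ha i).comp (Continuous.prodMk_right α)).smul
        continuous_const).intervalIntegrable _ _
  simp only [inner_eq]
  rw [intervalIntegral.integral_finsetSum]
  · simp only [intervalIntegral.integral_smul_const]
  · exact fun i _ => ((intervalIntegral.continuous_parametric_intervalIntegral_of_continuous
      (ha i) continuous_id).smul continuous_const).intervalIntegrable _ _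

/-- Exact velocity formula for a regularized Stokeslet surface with linear force
density over a triangle: the iterated integral of the kernel applied to the
force equals the `T_{m,n,q}`-weighted combination of the constant vectors, and
consequently `(8πμ/BH) u(x_f)` equals this combination. -/
theorem regularized_stokeslet_surface_velocity_formula
    (y₀ y₁ y₂ xf f₀ f₁ f₂ : EuclideanSpace ℝ (Fin 3))
    (hy01 : y₀ ≠ y₁) (hy12 : y₁ ≠ y₂)
    (L₁ L₂ ε : ℝ) (v w x₀ fa fb : EuclideanSpace ℝ (Fin 3))
    (hL₁ : L₁ = ‖y₀ - y₁‖) (hv : v = L₁⁻¹ • (y₀ - y₁))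
    (hL₂ : L₂ = ‖y₁ - y₂‖) (hw : w = L₂⁻¹ • (y₁ - y₂))
    (hx₀ : x₀ = xf - y₀) (hε : 0 < ε)
    (hfa : fa = f₁ - f₀) (hfb : fb = f₂ - f₁)
    (y : ℝ → ℝ → EuclideanSpace ℝ (Fin 3))
    (hy : ∀ α β : ℝ, y α β = y₀ - (α * L₁) • v - (β * L₂) • w)
    (f : ℝ → ℝ → EuclideanSpace ℝ (Fin 3))
    (hf : ∀ α β : ℝ, f α β = f₀ + α • fa + β • fb)
    (R : ℝ → ℝ → ℝ)
    (hR : ∀ α β : ℝ, R α β = Real.sqrt (‖xf - y α β‖^2 + ε^2))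
    (S : EuclideanSpace ℝ (Fin 3) → EuclideanSpace ℝ (Fin 3) →
         EuclideanSpace ℝ (Fin 3) → EuclideanSpace ℝ (Fin 3))
    (hS : ∀ x yy g, S x yy g =
      (1 / Real.sqrt (‖x - yy‖^2 + ε^2) +
        ε^2 / (Real.sqrt (‖x - yy‖^2 + ε^2))^3) • g +
      (⟪x - yy, g⟫ / (Real.sqrt (‖x - yy‖^2 + ε^2))^3) • (x - yy))
    (P₀₀ P₁₀ P₀₁ P₂₀ P₁₁ P₀₂ P₃₀ P₂₁ P₁₂ P₀₃ : EuclideanSpace ℝ (Fin 3))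
    (hP₀₀ : P₀₀ = ε^2 • f₀ + ⟪f₀, x₀⟫ • x₀)
    (hP₁₀ : P₁₀ = ε^2 • fa + (L₁ * ⟪f₀, v⟫ + ⟪fa, x₀⟫) • x₀ +
      (L₁ * ⟪f₀, x₀⟫) • v)
    (hP₀₁ : P₀₁ = ε^2 • fb + (L₂ * ⟪f₀, w⟫ + ⟪fb, x₀⟫) • x₀ +
      (L₂ * ⟪f₀, x₀⟫) • w)
    (hP₂₀ : P₂₀ = (L₁ * ⟪fa, v⟫) • x₀ + (L₁^2 * ⟪f₀, v⟫ + L₁ * ⟪fa, x₀⟫) • v)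
    (hP₁₁ : P₁₁ = (L₁ * ⟪fb, v⟫ + L₂ * ⟪fa, w⟫) • x₀ +
      (L₁ * L₂ * ⟪f₀, w⟫ + L₁ * ⟪fb, x₀⟫) • v +
      (L₁ * L₂ * ⟪f₀, v⟫ + L₂ * ⟪fa, x₀⟫) • w)
    (hP₀₂ : P₀₂ = (L₂ * ⟪fb, w⟫) • x₀ + (L₂^2 * ⟪f₀, w⟫ + L₂ * ⟪fb, x₀⟫) • w)
    (hP₃₀ : P₃₀ = (L₁^2 * ⟪fa, v⟫) • v)
    (hP₂₁ : P₂₁ = (L₁ * L₂ * ⟪fa, w⟫ + L₁^2 * ⟪fb, v⟫) • v +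
      (L₁ * L₂ * ⟪fa, v⟫) • w)
    (hP₁₂ : P₁₂ = (L₁ * L₂ * ⟪fb, v⟫ + L₂^2 * ⟪fa, w⟫) • w +
      (L₁ * L₂ * ⟪fb, w⟫) • v)
    (hP₀₃ : P₀₃ = (L₂^2 * ⟪fb, w⟫) • w)
    (T : ℕ → ℕ → ℝ → ℝ)
    (hT : ∀ (m n : ℕ) (q : ℝ),
      T m n q = ∫ α in (0:ℝ)..1, ∫ β in (0:ℝ)..α, α ^ m * β ^ n * R α β ^ (-q))
    (μ BH : ℝ) (hμ : 0 < μ) (hBH : BH ≠ 0)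
    (u : EuclideanSpace ℝ (Fin 3))
    (hu : u = (BH / (8 * Real.pi * μ)) •
      ∫ α in (0:ℝ)..1, ∫ β in (0:ℝ)..α, S xf (y α β) (f α β)) :
    (∫ α in (0:ℝ)..1, ∫ β in (0:ℝ)..α, S xf (y α β) (f α β)) =
      T 0 0 1 • f₀ + T 0 0 3 • P₀₀ + T 1 0 1 • fa + T 1 0 3 • P₁₀ +
      T 0 1 1 • fb + T 0 1 3 • P₀₁ + T 2 0 3 • P₂₀ + T 1 1 3 • P₁₁ +
      T 0 2 3 • P₀₂ + T 3 0 3 • P₃₀ + T 2 1 3 • P₂₁ + T 1 2 3 • P₁₂ +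
      T 0 3 3 • P₀₃ ∧
    (8 * Real.pi * μ / BH) • u =
      T 0 0 1 • f₀ + T 0 0 3 • P₀₀ + T 1 0 1 • fa + T 1 0 3 • P₁₀ +
      T 0 1 1 • fb + T 0 1 3 • P₀₁ + T 2 0 3 • P₂₀ + T 1 1 3 • P₁₁ +
      T 0 2 3 • P₀₂ + T 3 0 3 • P₃₀ + T 2 1 3 • P₂₁ + T 1 2 3 • P₁₂ +
      T 0 3 3 • P₀₃ := by
  have R_pos (α β : ℝ) : 0 < R α β := by
    rw [hR]
    positivity
  have R_cont : Continuous (Function.uncurry R) := by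
    have : Function.uncurry R = fun z : ℝ × ℝ =>
        Real.sqrt (‖xf - (y₀ - (z.1 * L₁) • v - (z.2 * L₂) • w)‖ ^ 2 + ε ^ 2) := by
      funext z
      simp only [Function.uncurry, hR, hy]
    rw [this]
    fun_prop
  let e : Fin 13 → ℕ × ℕ × ℝ := ![(0, 0, 1), (0, 0, 3), (1, 0, 1), (1, 0, 3), (0, 1, 1),
    (0, 1, 3), (2, 0, 3), (1, 1, 3), (0, 2, 3), (3, 0, 3), (2, 1, 3), (1, 2, 3), (0, 3, 3)]
  let p : Fin 13 → EuclideanSpace ℝ (Fin 3) :=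
    ![f₀, P₀₀, fa, P₁₀, fb, P₀₁, P₂₀, P₁₁, P₀₂, P₃₀, P₂₁, P₁₂, P₀₃]
  let a : Fin 13 → ℝ → ℝ → ℝ := fun i α β =>
    α ^ (e i).1 * β ^ (e i).2.1 * R α β ^ (-(e i).2.2)
  have a_cont (i : Fin 13) : Continuous (Function.uncurry (a i)) :=
    ((continuous_fst.pow _).mul (continuous_snd.pow _)).mul
      (R_cont.rpow_const fun z => Or.inl (R_pos z.1 z.2).ne')
  have kernel_eq (α β : ℝ) : S xf (y α β) (f α β) = ∑ i, a i α β • p i := by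
    have h_diff : xf - y α β = x₀ + (α * L₁) • v + (β * L₂) • w := by
      rw [hy, hx₀]
      abel
    have h_one : R α β ^ (-1 : ℝ) = (R α β)⁻¹ := Real.rpow_neg_one _
    have h_three : R α β ^ (-3 : ℝ) = (R α β ^ 3)⁻¹ := by
      rw [Real.rpow_neg (R_pos α β).le, Real.rpow_ofNat]
    rw [hS, ← hR, h_diff, hf]
    simp only [Fin.sum_univ_succ, Fin.sum_univ_zero, a, e, p, Matrix.cons_val_zero,
      Matrix.cons_val_succ, h_one, h_three, div_eq_mul_inv]
    simp only [hP₀₀, hP₁₀, hP₀₁, hP₂₀, hP₁₁, hP₀₂, hP₃₀, hP₂₁, hP₁₂, hP₀₃,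
      inner_add_left, inner_add_right, real_inner_smul_right,
      real_inner_comm f₀, real_inner_comm fa, real_inner_comm fb]
    module
  have main : (∫ α in (0:ℝ)..1, ∫ β in (0:ℝ)..α, S xf (y α β) (f α β)) =
      T 0 0 1 • f₀ + T 0 0 3 • P₀₀ + T 1 0 1 • fa + T 1 0 3 • P₁₀ +
      T 0 1 1 • fb + T 0 1 3 • P₀₁ + T 2 0 3 • P₂₀ + T 1 1 3 • P₁₁ +
      T 0 2 3 • P₀₂ + T 3 0 3 • P₃₀ + T 2 1 3 • P₂₁ + T 1 2 3 • P₁₂ +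
      T 0 3 3 • P₀₃ := by
    simp only [kernel_eq]
    rw [integral_triangle_sum_smul_const _ a a_cont]
    simp only [a, ← hT]
    simp only [Fin.sum_univ_succ, Fin.sum_univ_zero, e, p, Matrix.cons_val_zero,
      Matrix.cons_val_succ]
    abel
  refine ⟨main, ?_⟩
  have h_scale : 8 * Real.pi * μ / BH * (BH / (8 * Real.pi * μ)) = 1 := by
    have := Real.pi_pos
    field_simp
  rw [hu, smul_smul, h_scale, one_smul, main]
end
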